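/- arXiv:2303.12036 — 3 statements merged into one kernel-verified Lean document; each statement's English description precedes it below -/
import Mathlib

section
/- Let X ⊆ ℝⁿ be closed and F : ℝⁿ → ℝⁿ continuous, and define the gap function ν(x) := inf_{y∈X} ⟪y − x, F(x)⟫. Let (u⁽ᵏ⁾) and (v⁽ᵏ⁾) be sequences in X such that for every k: ⟪v⁽ᵏ⁾ − u⁽ᵏ⁾, F(u⁽ᵏ⁾)⟫ = ν(u⁽ᵏ⁾) (i.e., v⁽ᵏ⁾ minimizes y ↦ ⟪y − u⁽ᵏ⁾, F(u⁽ᵏ⁾)⟫ over X), ν(u⁽ᵏ⁾) < 0, and ⟪v⁽ⁱ⁾ − u⁽ʲ⁾, F(u⁽ʲ⁾)⟫ ≥ 0 for all i < j. Suppose u⁽ᵏ⁾ → u*, the function ν is real-valued and continuous at u*, and the sequence (v⁽ᵏ⁾) has a convergent subsequence. Then ν(u*) = 0, i.e., u* ∈ SOL(X,F). -/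
open Filter

theorem stmt2 (n : ℕ) (X : Set (Fin n → ℝ)) (hX : IsClosed X)
    (F : (Fin n → ℝ) → (Fin n → ℝ)) (hF : Continuous F)
    (nu : (Fin n → ℝ) → ℝ)
    (u v : ℕ → Fin n → ℝ) (ustar : Fin n → ℝ)
    (hu : ∀ k, u k ∈ X) (hv : ∀ k, v k ∈ X)
    -- `ν(u⁽ᵏ⁾)` is the (real-valued) infimum of `y ↦ ⟪y − u⁽ᵏ⁾, F(u⁽ᵏ⁾)⟫` over `X` …
    (hnuGLB : ∀ k, IsGLB ((fun y => ∑ i, (y i - u k i) * F (u k) i) '' X) (nu (u k)))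
    -- … attained at `v⁽ᵏ⁾`
    (hattain : ∀ k, (∑ i, (v k i - u k i) * F (u k) i) = nu (u k))
    (hneg : ∀ k, nu (u k) < 0)
    (hcut : ∀ i j, i < j → 0 ≤ ∑ t, (v i t - u j t) * F (u j) t)
    (hconv : Tendsto u atTop (nhds ustar))
    -- `ν` is real-valued at `u*` …
    (hnuStar : IsGLB ((fun y => ∑ i, (y i - ustar i) * F ustar i) '' X) (nu ustar))
    -- … and continuous at `u*`
    (hcont : ContinuousAt nu ustar)
    -- `(v⁽ᵏ⁾)` has a convergent subsequence
    (hsub : ∃ φ : ℕ → ℕ, StrictMono φ ∧ ∃ vstar, Tendsto (v ∘ φ) atTop (nhds vstar)) :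
    nu ustar = 0 ∧ ustar ∈ X ∧ ∀ y ∈ X, 0 ≤ ∑ i, (y i - ustar i) * F ustar i := by
  have hg : Continuous fun p : (Fin n → ℝ) × (Fin n → ℝ) =>
      ∑ i, (p.1 i - p.2 i) * F p.2 i := by fun_prop
  obtain ⟨φ, hφ, vstar, hvstar⟩ := hsub
  have hsucc : Tendsto (fun k => φ (k + 1)) atTop atTop :=
    hφ.tendsto_atTop.comp (tendsto_add_atTop_nat 1)
  have husucc := hconv.comp hsucc
  have hvsucc := hvstar.comp (tendsto_add_atTop_nat 1)
  have hgap := (hg.tendsto (vstar, ustar)).comp (hvsucc.prodMk_nhds husucc)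
  have hlag := (hg.tendsto (vstar, ustar)).comp (hvstar.prodMk_nhds husucc)
  have hgap_eq := tendsto_nhds_unique (hcont.tendsto.comp husucc)
    (hgap.congr fun k => hattain (φ (k + 1)))
  have hlag_nonneg := ge_of_tendsto' hlag fun k => hcut _ _ (hφ k.lt_succ_self)
  have hnu : nu ustar = 0 :=
    le_antisymm (le_of_tendsto' (hcont.tendsto.comp hconv) fun k => (hneg k).le)
      (hgap_eq ▸ hlag_nonneg)
  exact ⟨hnu, hX.mem_of_tendsto hconv (Eventually.of_forall hu),
    fun y hy => hnu ▸ hnuStar.1 ⟨y, hy, rfl⟩⟩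
end

section
/- Fix positive integers n, m, degrees a₁,…,aₙ, b₁,…,b_m ∈ ℕ₊, and a partition of {1,…,m} into disjoint sets E and I. Identify each tuple (F₁,…,Fₙ, g₁,…,g_m) of real polynomials in n variables with deg Fᵢ ≤ aᵢ and deg gⱼ ≤ bⱼ with its vector of coefficients in ℝᴺ (N the total number of coefficients). Then there is a set 𝒩 ⊆ ℝᴺ of Lebesgue measure zero such that for every coefficient vector outside 𝒩, the variational inequality VI(X,F) with X = {x : gᵢ(x) ≥ 0 (i ∈ I), gᵢ(x) = 0 (i ∈ E)} satisfies: every x ∈ SOL(X,F) is a KKT point of VI(X,F), and the set of KKT points of VI(X,F) is finite. -/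
open MvPolynomial

/-- The polynomial in `n` variables of degree at most `a` whose coefficient on the
monomial with exponent tuple `e` (with `∑ e ≤ a`) is `c e`. -/
noncomputable def polyOfCoeffs {n a : ℕ}
    (c : {e : Fin n → Fin (a + 1) // (∑ k, (e k : ℕ)) ≤ a} → ℝ) :
    MvPolynomial (Fin n) ℝ :=
  ∑ e : {e : Fin n → Fin (a + 1) // (∑ k, (e k : ℕ)) ≤ a},
    MvPolynomial.C (c e) * ∏ k, MvPolynomial.X k ^ ((e.1 k : ℕ))

section NondegenerateZeros

variable {σ : Type*} [Fintype σ]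

/-- First-order Taylor expansion of a polynomial modulo the square of the maximal ideal of a
point. -/
theorem MvPolynomial.sub_linearization_mem_ker_eval_sq {k : Type*} [Field k] (z : σ → k)
    (p : MvPolynomial σ k) :
    p - C (eval z p) - ∑ i, C (eval z (pderiv i p)) * (X i - C (z i)) ∈
      RingHom.ker (eval z) ^ 2 := by
  classical
  induction p using MvPolynomial.induction_on with
  | C r => simp
  | add p q hp hq =>
    convert Ideal.add_mem _ hp hq using 1
    simp only [map_add, add_mul, Finset.sum_add_distrib]
    ring
  | mul_X p j hp =>
    have h₁ : p - C (eval z p) ∈ RingHom.ker (eval z) := by simp [RingHom.mem_ker]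
    have h₂ : X j - C (z j) ∈ RingHom.ker (eval z) := by simp [RingHom.mem_ker]
    have h₃ := Ideal.add_mem _ (Ideal.mul_mem_right (C (z j)) _ hp)
      (by simpa [pow_two] using Ideal.mul_mem_mul h₁ h₂)
    convert h₃ using 1
    have h₄ : ∑ i, C (eval z (pderiv i (p * X j))) * (X i - C (z i)) =
        C (z j) * ∑ i, C (eval z (pderiv i p)) * (X i - C (z i)) +
          C (eval z p) * (X j - C (z j)) := by
      have : ∀ i, C (eval z (pderiv i (p * X j))) * (X i - C (z i)) =
          C (z j) * (C (eval z (pderiv i p)) * (X i - C (z i))) +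
            if i = j then C (eval z p) * (X j - C (z j)) else 0 := by
        intro i
        by_cases h : i = j
        · subst h
          simp [Derivation.leibniz]
          ring
        · simp [Derivation.leibniz, pderiv_X_of_ne (Ne.symm h), h]
          ring
      rw [Finset.sum_congr rfl fun i _ => this i]
      simp [Finset.sum_add_distrib, Finset.mul_sum]
    rw [h₄]
    simp only [map_mul, eval_X]
    ring

/-- The square matrix of partial derivatives of a square polynomial system at a point. -/
noncomputable def jacobianAt {k : Type*} [CommRing k] (P : σ → MvPolynomial σ k) (z : σ → k) :
    Matrix σ σ k :=
  Matrix.of fun s i => eval z (pderiv i (P s))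

/-- A square polynomial system over a field has only finitely many nondegenerate zeros. -/
theorem finite_nondegenerate_zeros {k : Type*} [Field k] [DecidableEq σ]
    (P : σ → MvPolynomial σ k) :
    {z : σ → k | (∀ s, eval z (P s) = 0) ∧ (jacobianAt P z).det ≠ 0}.Finite := by
  set J := Ideal.span (Set.range P) with hJ
  refine Set.Finite.of_finite_image (f := fun z : σ → k => RingHom.ker (eval z))
    ((J.finite_minimalPrimes_of_isNoetherianRing).subset ?_) ?_
  · rintro _ ⟨z, ⟨hz, hdet⟩, rfl⟩
    set m := RingHom.ker (eval z) with hm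
    have hJm : J ≤ m := by
      rw [hJ, Ideal.span_le]
      rintro _ ⟨s, rfl⟩
      exact hz s
    have hlin : ∀ s, ∑ i, C (eval z (pderiv i (P s))) * (X i - C (z i)) ∈ J ⊔ m ^ 2 := by
      intro s
      have h₁ := sub_linearization_mem_ker_eval_sq z (P s)
      have h₂ : P s ∈ J := Ideal.subset_span ⟨s, rfl⟩
      have h₃ := Ideal.sub_mem _ (Submodule.mem_sup_left (T := m ^ 2) h₂)
        (Submodule.mem_sup_right (S := J) h₁)
      simpa [hz s] using h₃
    have hX : ∀ l, X l - C (z l) ∈ J ⊔ m ^ 2 := by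
      intro l
      have hinv := Matrix.nonsing_inv_mul (jacobianAt P z) (isUnit_iff_ne_zero.2 hdet)
      have h₁ : ∑ s, C ((jacobianAt P z)⁻¹ l s) *
          ∑ i, C (eval z (pderiv i (P s))) * (X i - C (z i)) = X l - C (z l) := by
        have h₂ : ∀ i, ∑ s, (jacobianAt P z)⁻¹ l s * eval z (pderiv i (P s)) =
            (1 : Matrix σ σ k) l i := by
          intro i
          rw [← hinv, Matrix.mul_apply]
          rfl
        simp only [Finset.mul_sum]
        rw [Finset.sum_comm]
        simp only [← mul_assoc, ← Finset.sum_mul, ← C_mul]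
        simp only [← map_sum, h₂, Matrix.one_apply]
        simp [ite_mul]
      rw [← h₁]
      exact Ideal.sum_mem _ fun s _ => Ideal.mul_mem_left _ _ (hlin s)
    have hmle : m ≤ J ⊔ m ^ 2 := by
      intro p hp
      have h₁ := sub_linearization_mem_ker_eval_sq z p
      have h₂ : eval z p = 0 := hp
      have h₃ : ∑ i, C (eval z (pderiv i p)) * (X i - C (z i)) ∈ J ⊔ m ^ 2 :=
        Ideal.sum_mem _ fun i _ => Ideal.mul_mem_left _ _ (hX i)
      have h₄ := Ideal.add_mem _ (Submodule.mem_sup_right (S := J) h₁) h₃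
      simpa [h₂] using h₄
    refine ⟨⟨RingHom.ker_isPrime _, hJm⟩, ?_⟩
    rintro q ⟨hq, hJq⟩ hqm
    obtain ⟨r, hr, hrm⟩ := Submodule.exists_sub_one_mem_and_smul_eq_zero_of_fg_of_le_smul m
      (Submodule.map q.mkQ m) ((IsNoetherian.noetherian m).map _) (by
        rw [← Submodule.map_smul'']
        rintro _ ⟨p, hp, rfl⟩
        obtain ⟨u, hu, v, hv, rfl⟩ := Submodule.mem_sup.1 (hmle hp)
        refine ⟨v, by simpa [pow_two] using hv, ?_⟩
        have : q.mkQ u = 0 := by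
          rw [Submodule.mkQ_apply, Submodule.Quotient.mk_eq_zero]
          exact hJq hu
        rw [map_add, this, zero_add])
    have hrq : r ∉ q := fun h => by
      have h₁ : (1 : MvPolynomial σ k) ∈ m := by
        simpa using Ideal.sub_mem _ (hqm h) hr
      simp [hm, RingHom.mem_ker] at h₁
    intro p hp
    have h₁ := hrm _ (Submodule.mem_map_of_mem (f := q.mkQ) hp)
    rw [← map_smul, Submodule.mkQ_apply, Submodule.Quotient.mk_eq_zero] at h₁
    exact (hq.mem_or_mem h₁).resolve_left hrq
  · intro z _ w _ h
    ext i
    have h₁ : X i - C (z i) ∈ RingHom.ker (eval z) := by simp [RingHom.mem_ker]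
    have h₂ : X i - C (z i) ∈ RingHom.ker (eval w) := by
      have h' : RingHom.ker (eval z) = RingHom.ker (eval w) := h
      rwa [h'] at h₁
    simpa [RingHom.mem_ker, sub_eq_zero, eq_comm] using h₂

end NondegenerateZeros

section Calculus

open MeasureTheory

variable {σ : Type*} [Fintype σ]

theorem MvPolynomial.hasStrictFDerivAt_eval (p : MvPolynomial σ ℝ) (x : σ → ℝ) :
    HasStrictFDerivAt (fun y => eval y p)
      (∑ i, eval x (pderiv i p) • ContinuousLinearMap.proj (R := ℝ) (φ := fun _ : σ => ℝ) i) x := by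
  classical
  induction p using MvPolynomial.induction_on with
  | C r =>
    simpa using hasStrictFDerivAt_const (𝕜 := ℝ) r x
  | add p q hp hq =>
    simp only [map_add, add_smul, Finset.sum_add_distrib]
    exact hp.add hq
  | mul_X p j hp =>
    simp only [map_mul, eval_X]
    refine (hp.mul (ContinuousLinearMap.proj (R := ℝ) (φ := fun _ : σ => ℝ)
      j).hasStrictFDerivAt).congr_fderiv ?_
    ext v
    simp only [_root_.add_apply, _root_.smul_apply,
      _root_.sum_apply, ContinuousLinearMap.proj_apply, smul_eq_mul,
      Derivation.leibniz, map_add, map_mul, eval_X, add_mul, Finset.sum_add_distrib,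
      Finset.mul_sum]
    congr 1
    · rw [Finset.sum_eq_single j]
      · simp
      · intro i _ hi
        simp [pderiv_X_of_ne hi.symm]
      · simp
    · exact Finset.sum_congr rfl fun i _ => by ring

theorem MvPolynomial.differentiable_eval (p : MvPolynomial σ ℝ) :
    Differentiable ℝ fun y : σ → ℝ => eval y p :=
  fun x => (p.hasStrictFDerivAt_eval x).hasFDerivAt.differentiableAt

/-- Sard's theorem for the constant terms of a square polynomial system. -/
theorem volume_degenerate_constants_eq_zero [DecidableEq σ] (P : σ → MvPolynomial σ ℝ) :
    volume {t : σ → ℝ | ∃ z, (∀ s, eval z (P s) + t s = 0) ∧ (jacobianAt P z).det = 0} = 0 := by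
  have h := addHaar_image_eq_zero_of_det_fderivWithin_eq_zero (volume : Measure (σ → ℝ))
    (s := {z | (jacobianAt P z).det = 0}) (f := fun z s => - eval z (P s))
    (f' := fun z => ContinuousLinearMap.pi fun s =>
      -(∑ i, eval z (pderiv i (P s)) •
        ContinuousLinearMap.proj (R := ℝ) (φ := fun _ : σ => ℝ) i))
    (fun z _ => (hasFDerivAt_pi.2 fun s =>
      ((P s).hasStrictFDerivAt_eval z).hasFDerivAt.neg).hasFDerivWithinAt) (by
      intro z hz
      have : ((ContinuousLinearMap.pi fun s =>
          -(∑ i, eval z (pderiv i (P s)) •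
            ContinuousLinearMap.proj (R := ℝ) (φ := fun _ : σ => ℝ) i) :
            (σ → ℝ) →L[ℝ] (σ → ℝ)) : (σ → ℝ) →ₗ[ℝ] (σ → ℝ)) =
          Matrix.toLin' (-(jacobianAt P z)) := by
        refine LinearMap.ext fun v => funext fun s => ?_
        simp [jacobianAt, Matrix.mulVec, dotProduct]
      have hz' : (jacobianAt P z).det = 0 := hz
      rw [ContinuousLinearMap.det, this, LinearMap.det_toLin', Matrix.det_neg, hz', mul_zero])
  refine measure_mono_null ?_ h
  rintro t ⟨z, hz, hdet⟩
  exact ⟨z, hdet, funext fun s => by linarith [hz s]⟩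

end Calculus

section Genericity

open MeasureTheory

variable {K σ : Type*} [Fintype K]

theorem continuous_eval_linearMap (T : (K → ℝ) →ₗ[ℝ] MvPolynomial σ ℝ) :
    Continuous fun q : (K → ℝ) × (σ → ℝ) => eval q.2 (T q.1) := by
  classical
  have h : ∀ q : (K → ℝ) × (σ → ℝ), eval q.2 (T q.1) =
      ∑ i, q.1 i * eval q.2 (T fun j => if i = j then 1 else 0) := by
    intro q
    rw [T.pi_apply_eq_sum_univ, map_sum]
    simp only [smul_eval]
  simp only [h]
  refine continuous_finsetSum _ fun i _ => ?_
  exact ((continuous_apply i).comp continuous_fst).mul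
    ((MvPolynomial.continuous_eval _).comp continuous_snd)

/-- The projection of a closed set is null as soon as its intersections with all translates of the
image of a linear map are null. -/
theorem ae_not_exists_of_translates {ι Z : Type*} [Fintype ι] [TopologicalSpace Z]
    [SigmaCompactSpace Z] (L : (ι → ℝ) →ₗ[ℝ] (K → ℝ)) {S : Set ((K → ℝ) × Z)} (hS : IsClosed S)
    (h : ∀ c, volume {t : ι → ℝ | ∃ z, (c + L t, z) ∈ S} = 0) :
    ∀ᵐ c : K → ℝ, ¬ ∃ z, (c, z) ∈ S := by
  have hmeas : MeasurableSet {c : K → ℝ | ∃ z, (c, z) ∈ S} := by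
    have h₁ : {c : K → ℝ | ∃ z, (c, z) ∈ S} = Prod.fst '' S := by
      ext c
      simp
    obtain ⟨C, hC, hCS⟩ :=
      (isSigmaCompact_univ.of_isClosed_subset hS (Set.subset_univ _)).image continuous_fst
    rw [h₁, ← hCS]
    exact MeasurableSet.iUnion fun k => (hC k).measurableSet
  refine ae_mem_of_ae_add_linearMap_mem L volume volume hmeas.compl fun c => ?_
  rw [ae_iff]
  exact measure_mono_null (fun t ht => not_not.1 ht) (h c)

/-- If the constant terms of a square polynomial system depending linearly on parameters can be
varied independently, then the system has finitely many real zeros for almost all parameters. -/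
theorem ae_finite_zeros [Fintype σ] [DecidableEq σ]
    (T : σ → (K → ℝ) →ₗ[ℝ] MvPolynomial σ ℝ) (v : σ → K → ℝ)
    (hv : ∀ s s', T s (v s') = if s = s' then 1 else 0) :
    ∀ᵐ c : K → ℝ, {z : σ → ℝ | ∀ s, eval z (T s c) = 0}.Finite := by
  have hL : ∀ s t, T s (Fintype.linearCombination ℝ v t) = C (t s) := by
    intro s t
    simp [Fintype.linearCombination_apply, hv, smul_eq_C_mul]
  have hcl : IsClosed {q : (K → ℝ) × (σ → ℝ) | (∀ s, eval q.2 (T s q.1) = 0) ∧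
      (jacobianAt (fun s => T s q.1) q.2).det = 0} := by
    simp only [Set.ofPred_and, Set.ofPred_forall]
    refine (isClosed_iInter fun s => ?_).inter ?_
    · exact isClosed_eq (continuous_eval_linearMap (T s)) continuous_const
    · refine isClosed_eq (Continuous.matrix_det ?_) continuous_const
      exact continuous_matrix fun s i =>
        continuous_eval_linearMap ((pderiv i).toLinearMap ∘ₗ T s)
  filter_upwards [ae_not_exists_of_translates (Fintype.linearCombination ℝ v) hcl fun c => by
    refine measure_mono_null ?_ (volume_degenerate_constants_eq_zero fun s => T s c)
    rintro t ⟨z, hz, hdet⟩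
    refine ⟨z, fun s => by simpa [hL] using hz s, ?_⟩
    have : jacobianAt (fun s => T s (c + Fintype.linearCombination ℝ v t)) z =
        jacobianAt (fun s => T s c) z := by
      ext s i
      simp [jacobianAt, hL]
    rwa [← this]] with c hc
  refine (finite_nondegenerate_zeros fun s => T s c).subset fun z hz => ⟨hz, fun hdet => ?_⟩
  exact hc ⟨z, hz, hdet⟩

variable {τ A : Type*} [Fintype τ] [Fintype A]

/-- For almost all parameters, the Lagrange system `F x = ∑ j, μ j • ∇ (g j) x`, `g x = 0` has
finitely many solutions. -/
theorem ae_finite_lagrange [DecidableEq τ] [DecidableEq A]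
    (F : τ → (K → ℝ) →ₗ[ℝ] MvPolynomial τ ℝ)
    (G : A → (K → ℝ) →ₗ[ℝ] MvPolynomial τ ℝ) (u : τ → K → ℝ) (v : A → K → ℝ)
    (hFu : ∀ i i', F i (u i') = if i = i' then 1 else 0) (hFv : ∀ i j, F i (v j) = 0)
    (hGu : ∀ j i, G j (u i) = 0) (hGv : ∀ j j', G j (v j') = if j = j' then 1 else 0) :
    ∀ᵐ c : K → ℝ, {x : τ → ℝ | ∃ μ : A → ℝ,
      (∀ i, eval x (F i c) = ∑ j, μ j * eval x (pderiv i (G j c))) ∧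
      ∀ j, eval x (G j c) = 0}.Finite := by
  let R : MvPolynomial τ ℝ →ₗ[ℝ] MvPolynomial (τ ⊕ A) ℝ := (rename Sum.inl).toLinearMap
  let T : τ ⊕ A → (K → ℝ) →ₗ[ℝ] MvPolynomial (τ ⊕ A) ℝ :=
    Sum.elim
      (fun i => R ∘ₗ F i - ∑ j, LinearMap.mulLeft ℝ (X (Sum.inr j)) ∘ₗ R ∘ₗ
        (pderiv i).toLinearMap ∘ₗ G j)
      (fun j => R ∘ₗ G j)
  have hTv : ∀ s s', T s (Sum.elim u v s') = if s = s' then 1 else 0 := by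
    rintro (i | j) (i' | j')
    · simp [T, R, hFu, hGu, apply_ite]
    · have : ∀ j, pderiv i (G j (v j')) = 0 := by
        intro j
        rw [hGv]
        split_ifs <;> simp
      simp [T, R, hFv, this]
    · simp [T, R, hGu]
    · simp [T, R, hGv, apply_ite]
  filter_upwards [ae_finite_zeros T _ hTv] with c hc
  refine (hc.image fun z k => z (Sum.inl k)).subset ?_
  rintro x ⟨μ, hF, hG⟩
  refine ⟨Sum.elim x μ, ?_, rfl⟩
  have hx : ∀ p : MvPolynomial τ ℝ, eval (Sum.elim x μ) (rename Sum.inl p) = eval x p := by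
    intro p
    rw [eval_rename]
    rfl
  rintro (i | j)
  · simp [T, R, hx, hF]
  · simp [T, R, hx, hG]

/-- For almost all parameters, no linear relation with coefficient `1` at a fixed index holds
between the gradients at a common zero. -/
theorem ae_not_exists_gradient_relation [DecidableEq A] (G : A → (K → ℝ) →ₗ[ℝ] MvPolynomial τ ℝ)
    (j₀ : A) (w : τ → K → ℝ) (v : A → K → ℝ)
    (hGw : ∀ j k, G j (w k) = if j = j₀ then X k else 0)
    (hGv : ∀ j j', G j (v j') = if j = j' then 1 else 0) :
    ∀ᵐ c : K → ℝ, ¬ ∃ z : τ ⊕ A → ℝ, z (Sum.inr j₀) = 1 ∧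
      (∀ k, ∑ j, z (Sum.inr j) * eval (z ∘ Sum.inl) (pderiv k (G j c)) = 0) ∧
      ∀ j, eval (z ∘ Sum.inl) (G j c) = 0 := by
  classical
  set L := Fintype.linearCombination ℝ (Sum.elim w v) with hLdef
  have hL : ∀ j t, G j (L t) = C (t (Sum.inr j)) +
      if j = j₀ then ∑ k, C (t (Sum.inl k)) * X k else 0 := by
    intro j t
    simp only [hLdef, Fintype.linearCombination_apply, Fintype.sum_sum_type, map_add, map_sum,
      map_smul, Sum.elim_inl, Sum.elim_inr, hGw, hGv, smul_eq_C_mul]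
    split_ifs <;> simp [add_comm]
  have hres : Continuous fun q : (K → ℝ) × (τ ⊕ A → ℝ) => (q.1, q.2 ∘ Sum.inl) :=
    continuous_fst.prodMk (continuous_pi fun k => (continuous_apply (Sum.inl k)).comp continuous_snd)
  have heval : ∀ T : (K → ℝ) →ₗ[ℝ] MvPolynomial τ ℝ,
      Continuous fun q : (K → ℝ) × (τ ⊕ A → ℝ) => eval (q.2 ∘ Sum.inl) (T q.1) := fun T =>
    (continuous_eval_linearMap T).comp hres
  have hcoord : ∀ s, Continuous fun q : (K → ℝ) × (τ ⊕ A → ℝ) => q.2 s := fun s =>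
    (continuous_apply s).comp continuous_snd
  have hcl : IsClosed {q : (K → ℝ) × (τ ⊕ A → ℝ) | q.2 (Sum.inr j₀) = 1 ∧
      (∀ k, ∑ j, q.2 (Sum.inr j) * eval (q.2 ∘ Sum.inl) (pderiv k (G j q.1)) = 0) ∧
      ∀ j, eval (q.2 ∘ Sum.inl) (G j q.1) = 0} := by
    simp only [Set.ofPred_and, Set.ofPred_forall]
    exact (isClosed_eq (hcoord _) continuous_const).inter
      ((isClosed_iInter fun k => isClosed_eq (continuous_finsetSum _ fun j _ =>
          (hcoord _).mul (heval ((pderiv k).toLinearMap ∘ₗ G j))) continuous_const).inter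
        (isClosed_iInter fun j => isClosed_eq (heval (G j)) continuous_const))
  refine ae_not_exists_of_translates L hcl fun c => ?_
  have hdiff : ∀ p : MvPolynomial τ ℝ,
      Differentiable ℝ fun z : τ ⊕ A → ℝ => eval (z ∘ Sum.inl) p := fun p =>
    p.differentiable_eval.comp (g := fun y => eval y p) (f := fun z : τ ⊕ A → ℝ => z ∘ Sum.inl)
      (differentiable_pi.2 fun k => by simp only [Function.comp_apply]; fun_prop)
  let ℓ : (τ ⊕ A → ℝ) → τ → ℝ := fun z k =>
    -∑ j, z (Sum.inr j) * eval (z ∘ Sum.inl) (pderiv k (G j c))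
  have hℓ : ∀ k, Differentiable ℝ fun z => ℓ z k := fun k =>
    (Differentiable.fun_sum fun j _ => Differentiable.mul (by fun_prop) (hdiff _)).neg
  let Φ : (τ ⊕ A → ℝ) → τ ⊕ A → ℝ := fun z => Sum.elim (ℓ z) fun j =>
    -(eval (z ∘ Sum.inl) (G j c)) - if j = j₀ then ∑ k, ℓ z k * z (Sum.inl k) else 0
  have hΦ : Differentiable ℝ Φ := by
    refine differentiable_pi.2 ?_
    rintro (k | j)
    · exact hℓ k
    · refine (hdiff _).neg.sub ?_
      split_ifs
      · exact Differentiable.fun_sum fun k _ => (hℓ k).mul (by fun_prop)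
      · exact differentiable_const _
  refine measure_mono_null ?_ (addHaar_image_eq_zero_of_differentiableOn_of_addHaar_eq_zero
    (volume : Measure (τ ⊕ A → ℝ)) hΦ.differentiableOn
    (Measure.pi_hyperplane (fun _ => volume) (Sum.inr j₀) 1))
  rintro t ⟨z, hz, hgrad, hzero⟩
  replace hz : z (Sum.inr j₀) = 1 := hz
  have htl : ∀ k, t (Sum.inl k) = ℓ z k := by
    intro k
    have h₁ := hgrad k
    have h₂ : ∀ j, eval (z ∘ Sum.inl) (pderiv k (G j (c + L t))) =
        eval (z ∘ Sum.inl) (pderiv k (G j c)) + if j = j₀ then t (Sum.inl k) else 0 := by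
      intro j
      rw [map_add, hL]
      split_ifs
      · simp [pderiv_X, Pi.single_apply, eq_comm]
      · simp
    simp only [h₂, mul_add, Finset.sum_add_distrib, mul_ite, mul_zero, Finset.sum_ite_eq',
      Finset.mem_univ, if_true, hz, one_mul] at h₁
    simp only [ℓ]
    linarith
  refine ⟨z, hz, funext ?_⟩
  rintro (k | j)
  · exact (htl k).symm
  · have h₁ := hzero j
    rw [map_add, hL] at h₁
    simp only [Φ, Sum.elim_inr, ← htl]
    split_ifs at h₁ ⊢ <;> simp at h₁ ⊢ <;> linarith

/-- If constant and linear terms can be varied independently, then for almost all parameters the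
gradients are linearly independent at every common zero. -/
theorem ae_gradients_independent [DecidableEq A] (G : A → (K → ℝ) →ₗ[ℝ] MvPolynomial τ ℝ)
    (w : A → τ → K → ℝ) (v : A → K → ℝ)
    (hGw : ∀ j j' k, G j (w j' k) = if j = j' then X k else 0)
    (hGv : ∀ j j', G j (v j') = if j = j' then 1 else 0) :
    ∀ᵐ c : K → ℝ, ∀ x : τ → ℝ, (∀ j, eval x (G j c) = 0) → ∀ μ : A → ℝ,
      (∀ k, ∑ j, μ j * eval x (pderiv k (G j c)) = 0) → μ = 0 := by
  filter_upwards [ae_all_iff.2 fun j₀ => ae_not_exists_gradient_relation G j₀ (w j₀) v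
    (fun j k => hGw j j₀ k) hGv] with c hc x hx μ hμ
  by_contra hne
  obtain ⟨j₀, hj₀⟩ := Function.ne_iff.1 hne
  refine hc j₀ ⟨Sum.elim x ((μ j₀)⁻¹ • μ), by simpa using inv_mul_cancel₀ hj₀, fun k => ?_, hx⟩
  have := congrArg ((μ j₀)⁻¹ * ·) (hμ k)
  simpa [Finset.mul_sum, mul_assoc] using this

end Genericity

section NecessaryConditions

open Filter Topology

variable {τ J : Type*} [Fintype τ]

theorem HasDerivAt.nonneg_of_eventually_nonneg {h : ℝ → ℝ} {h' : ℝ} (hd : HasDerivAt h h' 0)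
    (h0 : h 0 = 0) (hpos : ∀ᶠ t in 𝓝[>] (0 : ℝ), 0 ≤ h t) : 0 ≤ h' := by
  have h₁ : Tendsto (slope h 0) (𝓝[>] 0) (𝓝 h') :=
    (hasDerivAt_iff_tendsto_slope.1 hd).mono_left (nhdsWithin_mono _ fun t ht => ne_of_gt ht)
  refine ge_of_tendsto h₁ ?_
  filter_upwards [hpos, self_mem_nhdsWithin] with t ht ht0
  rw [slope_def_field, h0, sub_zero, sub_zero]
  exact div_nonneg ht (le_of_lt ht0)

/-- A linear functional minimized over a polynomially constrained set at a point where the active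
gradients are linearly independent admits Karush-Kuhn-Tucker multipliers. -/
theorem exists_kkt_multipliers [Fintype J] [DecidableEq J] (E I : Set J)
    (hdisj : Disjoint E I) (hEI : E ∪ I = Set.univ)
    (g : J → MvPolynomial τ ℝ) (f x : τ → ℝ) (A : Finset J) (hA : ∀ j, j ∈ A ↔ eval x (g j) = 0)
    (hxI : ∀ j ∈ I, 0 ≤ eval x (g j)) (hxE : ∀ j ∈ E, eval x (g j) = 0)
    (hmin : ∀ y : τ → ℝ, (∀ j ∈ I, 0 ≤ eval y (g j)) ∧ (∀ j ∈ E, eval y (g j) = 0) →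
      0 ≤ ∑ i, (y i - x i) * f i)
    (hind : ∀ μ : A → ℝ, (∀ k, ∑ j, μ j * eval x (pderiv k (g j)) = 0) → μ = 0) :
    ∃ lam : J → ℝ, (∀ i, f i = ∑ j, lam j * eval x (pderiv i (g j))) ∧
      (∀ j ∈ E, eval x (g j) = 0) ∧
      ∀ j ∈ I, 0 ≤ lam j ∧ 0 ≤ eval x (g j) ∧ lam j * eval x (g j) = 0 := by
  classical
  have hactive : ∀ j : A, eval x (g j) = 0 := fun j => (hA j).1 j.2
  have hinactive : ∀ᶠ y in 𝓝 x, ∀ j, j ∉ A → 0 ≤ eval y (g j) := by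
    refine eventually_all.2 fun j => ?_
    by_cases hj : j ∈ A
    · simp [hj]
    have hjI : j ∈ I := by
      have : j ∈ E ∪ I := hEI ▸ Set.mem_univ j
      exact this.resolve_left fun h => hj ((hA j).2 (hxE j h))
    have hpos : 0 < eval x (g j) := lt_of_le_of_ne (hxI j hjI) fun h => hj ((hA j).2 h.symm)
    filter_upwards [((g j).continuous_eval.tendsto x).eventually_const_lt hpos] with y hy _
    exact hy.le
  let φ' : (τ → ℝ) →L[ℝ] ℝ := ∑ i, f i • ContinuousLinearMap.proj (R := ℝ) (φ := fun _ : τ => ℝ) i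
  have hφ' : ∀ y, φ' y = ∑ i, f i * y i := fun y => by simp [φ']
  have hfeas : ∀ᶠ y in 𝓝 x, (∀ j : A, 0 ≤ eval y (g j)) → (∀ j : A, ↑j ∈ E → eval y (g j) = 0) →
      φ' x ≤ φ' y := by
    filter_upwards [hinactive] with y hy hyA hyE
    have h₁ := hmin y ⟨fun j _ => ?_, fun j hj => hyE ⟨j, (hA j).2 (hxE j hj)⟩ hj⟩
    · rw [hφ', hφ', ← sub_nonneg, ← Finset.sum_sub_distrib]
      refine h₁.trans_eq (Finset.sum_congr rfl fun i _ => by ring)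
    · by_cases hj : j ∈ A
      · exact hyA ⟨j, hj⟩
      · exact hy j hj
  let G' : A → (τ → ℝ) →L[ℝ] ℝ := fun j => ∑ i, eval x (pderiv i (g j)) •
    ContinuousLinearMap.proj (R := ℝ) (φ := fun _ : τ => ℝ) i
  have hG' : ∀ j : A, HasStrictFDerivAt (fun y => eval y (g j)) (G' j) x := fun j =>
    (g j).hasStrictFDerivAt_eval x
  have hG'single : ∀ j k, G' j (Pi.single k 1) = eval x (pderiv k (g j)) := by
    intro j k
    simp [G', Pi.single_apply]
  have hind' : ∀ μ : A → ℝ, ∑ j, μ j • G' j = 0 → μ = 0 := by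
    intro μ hμ
    refine hind μ fun k => ?_
    have := congrArg (fun T : (τ → ℝ) →L[ℝ] ℝ => T (Pi.single k 1)) hμ
    simpa [hG'single] using this
  obtain ⟨ν, hν⟩ : ∃ ν : A → ℝ, ∑ j, ν j • G' j = φ' := by
    have hext : IsLocalExtrOn φ' {y | ∀ j : A, eval y (g j) = eval x (g j)} x := by
      left
      change ∀ᶠ y in 𝓝[_] x, _
      rw [eventually_nhdsWithin_iff]
      filter_upwards [hfeas] with y hy hyA
      have hy0 : ∀ j : A, eval y (g j) = 0 := fun j => (hyA j).trans (hactive j)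
      exact hy (fun j => (hy0 j).ge) fun j _ => hy0 j
    obtain ⟨Λ, Λ₀, hne, hsum⟩ :=
      hext.exists_multipliers_of_hasStrictFDerivAt hG' φ'.hasStrictFDerivAt
    have hΛ₀ : Λ₀ ≠ 0 := by
      rintro rfl
      exact hne (Prod.ext (hind' Λ (by simpa using hsum)) rfl)
    refine ⟨fun j => -(Λ₀⁻¹ * Λ j), ?_⟩
    ext y
    have h₁ : ∑ j, Λ j * G' j y + Λ₀ * φ' y = 0 := by
      simpa using congrArg (fun T : (τ → ℝ) →L[ℝ] ℝ => T y) hsum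
    have h₂ : (∑ j, -(Λ₀⁻¹ * Λ j) • G' j) y = -(Λ₀⁻¹ * ∑ j, Λ j * G' j y) := by
      simp [Finset.mul_sum, mul_assoc]
    rw [h₂, eq_neg_of_add_eq_zero_left h₁]
    field_simp
  have hsurj : Function.Surjective (LinearMap.pi fun j => (G' j : (τ → ℝ) →ₗ[ℝ] ℝ)) := by
    rw [← LinearMap.range_eq_top]
    by_contra hne
    obtain ⟨Λ, hΛ, hle⟩ := Submodule.exists_le_ker_of_lt_top _ (lt_top_iff_ne_top.2 hne)
    refine hΛ ?_
    have h₁ : ∀ u, Λ u = ∑ j, Λ (Pi.single j 1) * u j := by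
      intro u
      conv_lhs => rw [LinearMap.pi_apply_eq_sum_univ Λ u]
      refine Finset.sum_congr rfl fun j _ => ?_
      rw [smul_eq_mul, mul_comm]
      congr 2
      ext l
      simp [Pi.single_apply, eq_comm]
    have h₂ : (fun j => Λ (Pi.single j 1)) = 0 := by
      refine hind' _ (ContinuousLinearMap.ext fun y => ?_)
      have h₃ := hle (LinearMap.mem_range_self _ y)
      rw [LinearMap.mem_ker, h₁] at h₃
      simpa using h₃
    refine LinearMap.ext fun u => ?_
    rw [h₁]
    simp [funext_iff.1 h₂]
  obtain ⟨R₀, hR₀⟩ := LinearMap.exists_rightInverse_of_surjective _ (LinearMap.range_eq_top.2 hsurj)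
  let R : (A → ℝ) →L[ℝ] (τ → ℝ) := LinearMap.toContinuousLinearMap R₀
  have hR : ∀ u j, G' j (R u) = u j := fun u j => congrFun (LinearMap.congr_fun hR₀ u) j
  let Ψ : (A → ℝ) → A → ℝ := fun u j => eval (x + R u) (g j)
  have hΨ0 : Ψ 0 = 0 := funext fun j => by simpa [Ψ] using hactive j
  have hΨ : HasStrictFDerivAt Ψ
      ((ContinuousLinearEquiv.refl ℝ (A → ℝ) : (A → ℝ) ≃L[ℝ] (A → ℝ)) :
        (A → ℝ) →L[ℝ] (A → ℝ)) 0 := by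
    rw [hasStrictFDerivAt_pi']
    intro j
    have h₁ : HasStrictFDerivAt (fun y => eval y (g j)) (G' j) (x + R 0) := by simpa using hG' j
    refine (h₁.comp (0 : A → ℝ) (R.hasStrictFDerivAt.const_add x)).congr_fderiv ?_
    ext u
    simp [hR]
  have hν_nonneg : ∀ i : A, ↑i ∉ E → 0 ≤ ν i := by
    intro i hi
    set ψ := hΨ.localInverse Ψ _ 0 with hψ
    have hψ0 : ψ 0 = 0 := by
      have := hΨ.localInverse_apply_image
      rwa [hΨ0] at this
    have hψd : HasStrictFDerivAt ψ
        ((ContinuousLinearEquiv.refl ℝ (A → ℝ)).symm : (A → ℝ) →L[ℝ] (A → ℝ)) 0 := by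
      have := hΨ.to_localInverse
      rwa [hΨ0] at this
    have hψinv : ∀ᶠ u in 𝓝 (0 : A → ℝ), Ψ (ψ u) = u := by
      have := hΨ.eventually_right_inverse
      rwa [hΨ0] at this
    let e : ℝ → A → ℝ := fun t => t • Pi.single i 1
    have he : HasDerivAt e (Pi.single i 1) 0 := by
      simpa using (hasDerivAt_id (0 : ℝ)).smul_const (Pi.single i (1 : ℝ) : A → ℝ)
    have he0 : e 0 = 0 := by simp [e]
    have hψe : HasDerivAt (fun t => ψ (e t)) (Pi.single i 1) 0 := by
      have h₁ : HasFDerivAt ψ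
          ((ContinuousLinearEquiv.refl ℝ (A → ℝ)).symm : (A → ℝ) →L[ℝ] (A → ℝ)) (e 0) := by
        rw [he0]
        exact hψd.hasFDerivAt
      exact h₁.comp_hasDerivAt 0 he
    have hcurve : HasDerivAt (fun t => φ' (R (ψ (e t)))) (φ' (R (Pi.single i 1))) 0 :=
      φ'.hasFDerivAt.comp_hasDerivAt 0 (R.hasFDerivAt.comp_hasDerivAt 0 hψe)
    have hval : φ' (R (Pi.single i 1)) = ν i := by
      rw [← hν]
      simp [hR, Pi.single_apply]
    rw [← hval]
    refine hcurve.nonneg_of_eventually_nonneg (by simp [he0, hψ0]) ?_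
    have hetend : Tendsto e (𝓝 0) (𝓝 0) := by simpa [he0] using he.continuousAt.tendsto
    have hytend : Tendsto (fun t => x + R (ψ (e t))) (𝓝 0) (𝓝 x) := by
      have h₁ : ContinuousAt (fun t => x + R (ψ (e t))) 0 :=
        continuousAt_const.add (R.continuous.continuousAt.comp hψe.continuousAt)
      simpa [ContinuousAt, he0, hψ0] using h₁
    filter_upwards [nhdsWithin_le_nhds (hetend.eventually hψinv),
      nhdsWithin_le_nhds (hytend.eventually hfeas), self_mem_nhdsWithin] with t ht₁ ht₂ ht₀
    have hg : ∀ j : A, eval (x + R (ψ (e t))) (g j) = e t j := fun j => congrFun ht₁ j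
    have h₁ := ht₂ (fun j => by
        rw [hg]
        simp only [e, Pi.smul_apply, smul_eq_mul, Pi.single_apply]
        split_ifs
        · simpa using le_of_lt ht₀
        · simp) fun j hj => by
      have hne : j ≠ i := fun h => hi (h ▸ hj)
      rw [hg]
      simp [e, hne]
    simpa using h₁
  refine ⟨fun j => if h : j ∈ A then ν ⟨j, h⟩ else 0, fun i => ?_, hxE, fun j hj => ?_⟩
  · have h₁ : f i = ∑ j : A, ν j * eval x (pderiv i (g j)) := by
      have := congrArg (fun T : (τ → ℝ) →L[ℝ] ℝ => T (Pi.single i 1)) hν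
      simpa [hG'single, hφ', Pi.single_apply] using this.symm
    rw [h₁, ← Finset.sum_subset (Finset.subset_univ A) fun j _ hj => by simp [hj],
      ← Finset.sum_coe_sort A]
    exact Finset.sum_congr rfl fun j _ => by simp
  · refine ⟨?_, hxI j hj, ?_⟩ <;> beta_reduce
    · split_ifs with h
      · exact hν_nonneg ⟨j, h⟩ (hdisj.notMem_of_mem_right hj)
      · exact le_rfl
    · split_ifs with h
      · rw [(hA j).1 h, mul_zero]
      · exact zero_mul _

end NecessaryConditions

section CoefficientSpace

variable {n a : ℕ}

/-- `polyOfCoeffs` as a linear map. -/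
noncomputable def polyOfCoeffsₗ (n a : ℕ) :
    ({e : Fin n → Fin (a + 1) // (∑ k, (e k : ℕ)) ≤ a} → ℝ) →ₗ[ℝ] MvPolynomial (Fin n) ℝ where
  toFun := polyOfCoeffs
  map_add' c d := by simp [polyOfCoeffs, add_mul, Finset.sum_add_distrib]
  map_smul' r c := by simp [polyOfCoeffs, smul_eq_C_mul, mul_assoc, Finset.mul_sum]

theorem polyOfCoeffs_single (e : {e : Fin n → Fin (a + 1) // (∑ k, (e k : ℕ)) ≤ a}) :
    polyOfCoeffs (Pi.single e (1 : ℝ)) = ∏ k, X k ^ ((e.1 k : ℕ)) := by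
  simp [polyOfCoeffs, Pi.single_apply, apply_ite, ite_mul]

/-- The exponent tuple of the constant monomial. -/
def constExponent (n a : ℕ) : {e : Fin n → Fin (a + 1) // (∑ k, (e k : ℕ)) ≤ a} :=
  ⟨0, by simp⟩

/-- The exponent tuple of the `l`-th variable. -/
def linearExponent (ha : 0 < a) (l : Fin n) :
    {e : Fin n → Fin (a + 1) // (∑ k, (e k : ℕ)) ≤ a} :=
  ⟨Pi.single l ⟨1, by omega⟩, by
    have : ∀ k, (((Pi.single l ⟨1, by omega⟩ : Fin n → Fin (a + 1)) k : Fin (a + 1)) : ℕ) =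
        if k = l then 1 else 0 := by
      intro k
      by_cases h : k = l
      · subst h
        simp
      · simp [h]
    simp only [this, Finset.sum_ite_eq', Finset.mem_univ, if_true]
    omega⟩

theorem polyOfCoeffs_single_constExponent :
    polyOfCoeffs (Pi.single (constExponent n a) (1 : ℝ)) = 1 := by
  simp [polyOfCoeffs_single, constExponent]

theorem polyOfCoeffs_single_linearExponent (ha : 0 < a) (l : Fin n) :
    polyOfCoeffs (Pi.single (linearExponent ha l) (1 : ℝ)) = X l := by
  rw [polyOfCoeffs_single, Finset.prod_eq_single l]
  · simp [linearExponent]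
  · intro k _ hk
    simp [linearExponent, hk]
  · simp

end CoefficientSpace

section CoefficientFamilies

variable {n : ℕ} {ι κ : Type*} {d : κ → ℕ}

/-- The polynomial at index `i` of a family of polynomials, as a linear function of the vector of
all coefficients, where `f` embeds the coefficients of the family into that vector. -/
noncomputable def familyPoly (f : (Σ i : κ, {e : Fin n → Fin (d i + 1) // (∑ k, (e k : ℕ)) ≤ d i})
    → ι) (i : κ) : (ι → ℝ) →ₗ[ℝ] MvPolynomial (Fin n) ℝ :=
  polyOfCoeffsₗ n (d i) ∘ₗ LinearMap.funLeft ℝ ℝ fun e => f ⟨i, e⟩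

theorem familyPoly_single [DecidableEq ι] [DecidableEq κ]
    {f : (Σ i : κ, {e : Fin n → Fin (d i + 1) // (∑ k, (e k : ℕ)) ≤ d i}) → ι}
    (hf : Function.Injective f) (i i' : κ)
    (e : {e : Fin n → Fin (d i' + 1) // (∑ k, (e k : ℕ)) ≤ d i'}) :
    familyPoly f i (Pi.single (f ⟨i', e⟩) 1) =
      if i = i' then polyOfCoeffs (Pi.single e (1 : ℝ)) else 0 := by
  split_ifs with h
  · subst h
    change polyOfCoeffs _ = _
    congr 1
    ext e'
    simp [LinearMap.funLeft_apply, Pi.single_apply, hf.eq_iff]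
  · have : (LinearMap.funLeft ℝ ℝ fun e => f ⟨i, e⟩)
        (Pi.single (f ⟨i', e⟩) 1 : ι → ℝ) = 0 := by
      ext e'
      have hne : f ⟨i, e'⟩ ≠ f ⟨i', e⟩ := fun h' => h (congrArg Sigma.fst (hf h'))
      simp [LinearMap.funLeft_apply, hne]
    simp [familyPoly, this]

theorem familyPoly_single_of_notMem [DecidableEq ι]
    {f : (Σ i : κ, {e : Fin n → Fin (d i + 1) // (∑ k, (e k : ℕ)) ≤ d i}) → ι} (i : κ) {s : ι}
    (hs : s ∉ Set.range f) : familyPoly f i (Pi.single s 1) = 0 := by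
  have : (LinearMap.funLeft ℝ ℝ fun e => f ⟨i, e⟩) (Pi.single s 1 : ι → ℝ) = 0 := by
    ext e'
    have hne : f ⟨i, e'⟩ ≠ s := fun h => hs ⟨_, h⟩
    simp [LinearMap.funLeft_apply, hne]
  simp [familyPoly, this]

end CoefficientFamilies

theorem stmt4 (n m : ℕ) (hn : 0 < n) (hm : 0 < m)
    (a : Fin n → ℕ) (b : Fin m → ℕ) (ha : ∀ i, 0 < a i) (hb : ∀ j, 0 < b j)
    (E I : Set (Fin m)) (hEI : Disjoint E I) (hUnion : E ∪ I = Set.univ) :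
    ∃ N : Set (((Σ i : Fin n, {e : Fin n → Fin (a i + 1) // (∑ k, (e k : ℕ)) ≤ a i}) ⊕
        (Σ j : Fin m, {e : Fin n → Fin (b j + 1) // (∑ k, (e k : ℕ)) ≤ b j})) → ℝ),
      MeasureTheory.volume N = 0 ∧
      ∀ c ∉ N,
        ∀ (F : Fin n → MvPolynomial (Fin n) ℝ) (g : Fin m → MvPolynomial (Fin n) ℝ),
        (∀ i, F i = polyOfCoeffs (fun e => c (Sum.inl ⟨i, e⟩))) →
        (∀ j, g j = polyOfCoeffs (fun e => c (Sum.inr ⟨j, e⟩))) →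
        -- every solution of VI(X,F) is a KKT point, and the set of KKT points is finite
        ((∀ x ∈ {x : Fin n → ℝ |
              ((∀ j ∈ I, 0 ≤ eval x (g j)) ∧ (∀ j ∈ E, eval x (g j) = 0)) ∧
              ∀ y : Fin n → ℝ,
                ((∀ j ∈ I, 0 ≤ eval y (g j)) ∧ (∀ j ∈ E, eval y (g j) = 0)) →
                0 ≤ ∑ i, (y i - x i) * eval x (F i)},
            x ∈ {x : Fin n → ℝ | ∃ lam : Fin m → ℝ,
              (∀ i, eval x (F i) = ∑ j, lam j * eval x (pderiv i (g j))) ∧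
              (∀ j ∈ E, eval x (g j) = 0) ∧
              (∀ j ∈ I, 0 ≤ lam j ∧ 0 ≤ eval x (g j) ∧ lam j * eval x (g j) = 0)}) ∧
          {x : Fin n → ℝ | ∃ lam : Fin m → ℝ,
              (∀ i, eval x (F i) = ∑ j, lam j * eval x (pderiv i (g j))) ∧
              (∀ j ∈ E, eval x (g j) = 0) ∧
              (∀ j ∈ I, 0 ≤ lam j ∧ 0 ≤ eval x (g j) ∧ lam j * eval x (g j) = 0)}.Finite) := by
  classical
  let Fc := familyPoly (n := n) (d := a) (ι := (Σ i : Fin n,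
      {e : Fin n → Fin (a i + 1) // (∑ k, (e k : ℕ)) ≤ a i}) ⊕
    (Σ j : Fin m, {e : Fin n → Fin (b j + 1) // (∑ k, (e k : ℕ)) ≤ b j})) Sum.inl
  let Gc := familyPoly (n := n) (d := b) (ι := (Σ i : Fin n,
      {e : Fin n → Fin (a i + 1) // (∑ k, (e k : ℕ)) ≤ a i}) ⊕
    (Σ j : Fin m, {e : Fin n → Fin (b j + 1) // (∑ k, (e k : ℕ)) ≤ b j})) Sum.inr
  have hfin := MeasureTheory.ae_all_iff.2 fun A : Finset (Fin m) =>
    ae_finite_lagrange Fc (fun j : A => Gc j)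
      (fun i => Pi.single (Sum.inl ⟨i, constExponent n (a i)⟩) 1)
      (fun j => Pi.single (Sum.inr ⟨j, constExponent n (b j)⟩) 1)
      (fun i i' => by
        rw [familyPoly_single Sum.inl_injective, polyOfCoeffs_single_constExponent])
      (fun i j => familyPoly_single_of_notMem i (by simp))
      (fun j i => familyPoly_single_of_notMem _ (by simp))
      (fun j j' => by
        rw [familyPoly_single Sum.inr_injective, polyOfCoeffs_single_constExponent]
        exact if_congr Subtype.ext_iff.symm rfl rfl)
  have hind := MeasureTheory.ae_all_iff.2 fun A : Finset (Fin m) =>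
    ae_gradients_independent (fun j : A => Gc j)
      (fun j k => Pi.single (Sum.inr ⟨j, linearExponent (hb j) k⟩) 1)
      (fun j => Pi.single (Sum.inr ⟨j, constExponent n (b j)⟩) 1)
      (fun j j' k => by
        rw [familyPoly_single Sum.inr_injective, polyOfCoeffs_single_linearExponent]
        exact if_congr Subtype.ext_iff.symm rfl rfl)
      (fun j j' => by
        rw [familyPoly_single Sum.inr_injective, polyOfCoeffs_single_constExponent]
        exact if_congr Subtype.ext_iff.symm rfl rfl)
  refine ⟨_, MeasureTheory.ae_iff.1 (hfin.and hind), fun c hc F g hF hg => ?_⟩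
  obtain ⟨hfin, hind⟩ := not_not.1 hc
  obtain rfl : F = fun i => Fc i c := funext hF
  obtain rfl : g = fun j => Gc j c := funext hg
  refine ⟨?_, ?_⟩
  · rintro x ⟨⟨hxI, hxE⟩, hmin⟩
    exact exists_kkt_multipliers E I hEI hUnion (fun j => Gc j c) (fun i => eval x (Fc i c)) x
      (Finset.univ.filter fun j => eval x (Gc j c) = 0) (by simp) hxI hxE hmin
      (hind _ x fun j => (Finset.mem_filter.1 j.2).2)
  · refine (Set.finite_iUnion hfin).subset ?_
    rintro x ⟨lam, hF, hxE, hxI⟩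
    refine Set.mem_iUnion.2 ⟨Finset.univ.filter fun j => eval x (Gc j c) = 0,
      fun j => lam j, fun i => ?_, fun j => (Finset.mem_filter.1 j.2).2⟩
    rw [hF i, Finset.sum_coe_sort _ fun j => lam j * eval x (pderiv i (Gc j c)),
      Finset.sum_subset (Finset.filter_subset _ _)]
    intro j _ hj
    have hjI : j ∈ I := by
      have : j ∈ E ∪ I := hUnion ▸ Set.mem_univ j
      exact this.resolve_left fun h => hj (by simpa using hxE j h)
    have hlam : lam j = 0 :=
      (mul_eq_zero.1 (hxI j hjI).2.2).resolve_right fun h => hj (by simpa using h)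
    rw [hlam, zero_mul]
end

section
/- Let m ≤ n, let F₁,…,Fₙ ∈ ℂ[x₁,…,xₙ] with deg Fᵢ ≤ aᵢ, and let g₁,…,g_m ∈ ℂ[x₁,…,xₙ] with deg gⱼ = bⱼ ≥ 1. Consider the complex KKT system with all constraints active: S := {(x,λ) ∈ ℂⁿ × ℂᵐ : Fᵢ(x) = Σ_{j=1}^m λⱼ ∂gⱼ/∂xᵢ(x) for all i, and g₁(x) = ⋯ = g_m(x) = 0}. If S is a finite set, then the number of distinct points x ∈ ℂⁿ occurring in S is at most b₁b₂⋯b_m · S_{n−m}(max_i aᵢ, b₁,…,b_m), where for nonnegative integers c₁,…,c_k the complete symmetric function is S_r(c₁,…,c_k) := Σ_{i₁+⋯+i_k = r} c₁^{i₁} c₂^{i₂} ⋯ c_k^{i_k}. -/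
open MvPolynomial

/-- The `r`-th complete symmetric function on the letters `c 0, …, c (k-1)`:
`S_r(c) = ∑_{i₁+⋯+i_k = r} c₁^{i₁} ⋯ c_k^{i_k}`. -/
def completeSym {k : ℕ} (r : ℕ) (c : Fin k → ℕ) : ℕ :=
  ∑ e ∈ Finset.univ.filter (fun e : Fin k → Fin (r + 1) => (∑ t, (e t : ℕ)) = r),
    ∏ t, c t ^ (e t : ℕ)

theorem height_vanishingIdeal_singleton {K σ : Type*} [Field K] [IsAlgClosed K] [Finite σ]
    (p : σ → K) : (Nat.card σ : ℕ∞) ≤ (vanishingIdeal K {p}).height := by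
  have key : ∀ q : σ → K, (vanishingIdeal K {q}).height ≤ (vanishingIdeal K {p}).height := by
    intro q
    let f (c : σ → K) : MvPolynomial σ K →ₐ[K] MvPolynomial σ K := aeval fun i => X i + C (c i)
    have hf : ∀ c, (f c).comp (f (-c)) = AlgHom.id K _ := by
      intro c; ext i; simp [f]
    let e : MvPolynomial σ K ≃ₐ[K] MvPolynomial σ K :=
      AlgEquiv.ofAlgHom (f (q - p)) (f (-(q - p))) (hf _) (by simpa using hf (-(q - p)))
    have he : (vanishingIdeal K {p}).comap (e : MvPolynomial σ K ≃+* MvPolynomial σ K) =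
        vanishingIdeal K {q} := by
      ext g
      simp only [Ideal.mem_comap, mem_vanishingIdeal_singleton_iff]
      have : (aeval p).comp (e : MvPolynomial σ K →ₐ[K] MvPolynomial σ K) = aeval q := by
        ext i; simp [e, f]
      rw [← this]; rfl
    rw [← he, RingEquiv.height_comap]
  have h : ringKrullDim (MvPolynomial σ K) = Nat.card σ := by
    simp [MvPolynomial.ringKrullDim_of_isNoetherianRing]
  have h2 : ringKrullDim (MvPolynomial σ K) ≤ ((vanishingIdeal K {p}).height : WithBot ℕ∞) := by
    refine (ringKrullDim_le_iff_isMaximal_height_le _).mpr fun M hM => ?_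
    obtain ⟨q, rfl⟩ := eq_vanishingIdeal_singleton_of_isMaximal K hM
    exact_mod_cast key q
  rw [h] at h2
  exact_mod_cast h2

theorem vanishingIdeal_singleton_mem_minimalPrimes {K σ : Type*} [Field K] [IsAlgClosed K]
    [Finite σ] {I : Ideal (MvPolynomial σ K)} (hI : (zeroLocus K I).Finite) {p : σ → K}
    (hp : p ∈ zeroLocus K I) : vanishingIdeal K {p} ∈ I.minimalPrimes := by
  refine ⟨⟨(inferInstance : (vanishingIdeal K {p}).IsMaximal).isPrime, ?_⟩, ?_⟩
  · rw [← le_zeroLocus_iff_le_vanishingIdeal]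
    simpa using hp
  · rintro q ⟨hq, hIq⟩ hqp
    have hfin : (zeroLocus K q).Finite := hI.subset (zeroLocus_anti_mono hIq)
    have h1 : hfin.toFinset.inf (fun x => vanishingIdeal K {x}) ≤ q := by
      conv_rhs => rw [← IsPrime.vanishingIdeal_zeroLocus (K := K) q]
      intro g hg x hx
      have := (Submodule.mem_finsetInf.mp hg) x (by simpa using hx)
      simpa using this
    obtain ⟨x, hx, hxq⟩ := (Ideal.IsPrime.inf_le' hq).mp h1
    have hmax : (vanishingIdeal K {x}).IsMaximal := inferInstance
    have : vanishingIdeal K {x} = vanishingIdeal K {p} :=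
      hmax.eq_of_le (inferInstance : (vanishingIdeal K {p}).IsMaximal).ne_top (hxq.trans hqp)
    exact this ▸ hxq

theorem MvPolynomial.IsHomogeneous.eval_const_mul {A σ : Type*} [CommRing A]
    {h : MvPolynomial σ A} {d : ℕ} (hd : h.IsHomogeneous d) (t : A) (v : σ → A) :
    eval (fun i => t * v i) h = t ^ d * eval v h := by
  rw [eval_eq, eval_eq, Finset.mul_sum]
  refine Finset.sum_congr rfl fun e he => ?_
  have h1 : ∑ i ∈ e.support, e i = d := by
    have := hd (mem_support_iff.mp he)
    simpa [Finsupp.weight_apply, Finsupp.sum] using this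
  simp_rw [mul_pow, Finset.prod_mul_distrib]
  rw [Finset.prod_pow_eq_pow_sum, h1]
  ring

theorem exists_eval_const_mul {A σ : Type*} [CommRing A] (h : MvPolynomial σ A) {d : ℕ}
    (hd : ∀ e : σ →₀ ℕ, e.degree < d → coeff e h = 0) (t : A) (v : σ → A) :
    ∃ r, eval (fun i => t * v i) h = t ^ d * (eval v (homogeneousComponent d h) + t * r) := by
  have hz : ∀ i, i < d → homogeneousComponent i h = 0 := by
    intro i hi
    ext e
    rw [coeff_homogeneousComponent, coeff_zero]
    split_ifs with he
    · exact hd e (he ▸ hi)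
    · rfl
  have hs : h = ∑ i ∈ Finset.range (h.totalDegree + 1), homogeneousComponent (d + i) h := by
    conv_lhs => rw [← sum_homogeneousComponent h]
    have h1 : ∑ i ∈ Finset.range (h.totalDegree + 1), homogeneousComponent i h =
        ∑ i ∈ Finset.range (d + (h.totalDegree + 1)), homogeneousComponent i h := by
      refine Finset.sum_subset (Finset.range_subset_range.mpr (by omega)) fun i _ hi => ?_
      exact homogeneousComponent_eq_zero _ _ (by simpa using hi)
    rw [h1, Finset.sum_range_add, Finset.sum_eq_zero fun i hi => hz i (Finset.mem_range.mp hi),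
      zero_add]
  have key : ∀ i, eval (fun j => t * v j) (homogeneousComponent i h) =
      t ^ i * eval v (homogeneousComponent i h) := fun i =>
    (homogeneousComponent_isHomogeneous i h).eval_const_mul t v
  refine ⟨∑ i ∈ Finset.range h.totalDegree, t ^ i * eval v (homogeneousComponent (d + (i + 1)) h),
    ?_⟩
  conv_lhs => rw [hs]
  rw [map_sum, Finset.sum_range_succ', key, add_zero, mul_add, add_comm, Finset.mul_sum,
    Finset.mul_sum]
  congr 1
  refine Finset.sum_congr rfl fun i _ => ?_
  rw [key]
  ring

/-- The saturation `I : g^∞`. -/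
def saturation {R : Type*} [CommRing R] (I : Ideal R) (g : R) : Ideal R where
  carrier := {s | ∃ k : ℕ, g ^ k * s ∈ I}
  zero_mem' := ⟨0, by simp⟩
  add_mem' := by
    rintro s t ⟨k, hk⟩ ⟨l, hl⟩
    refine ⟨k + l, ?_⟩
    have : g ^ (k + l) * (s + t) = g ^ l * (g ^ k * s) + g ^ k * (g ^ l * t) := by ring
    rw [this]
    exact I.add_mem (I.mul_mem_left _ hk) (I.mul_mem_left _ hl)
  smul_mem' := by
    rintro c s ⟨k, hk⟩
    refine ⟨k, ?_⟩
    rw [smul_eq_mul, mul_left_comm]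
    exact I.mul_mem_left _ hk

/-- Starting from `I`, alternately saturate by and adjoin the members of the sequence `g`. -/
def residualIdeal {R : Type*} [CommRing R] : {m : ℕ} → Ideal R → (Fin m → R) → Ideal R
  | 0, I, _ => I
  | _ + 1, I, g => residualIdeal (saturation I (g 0) ⊔ Ideal.span {g 0}) (Fin.tail g)

theorem residualIdeal_mono {R : Type*} [CommRing R] {m : ℕ} {I J : Ideal R} (h : I ≤ J)
    (g : Fin m → R) : residualIdeal I g ≤ residualIdeal J g := by
  induction m generalizing I J with
  | zero => exact h
  | succ m ih =>
    refine ih (sup_le_sup_right (fun s hs => ?_) _) _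
    obtain ⟨k, hk⟩ := hs
    exact ⟨k, h hk⟩

theorem map_residualIdeal_le {R R' : Type*} [CommRing R] [CommRing R'] (f : R →+* R') {m : ℕ}
    (I : Ideal R) (g : Fin m → R) :
    (residualIdeal I g).map f ≤ residualIdeal (I.map f) (f ∘ g) := by
  induction m generalizing I with
  | zero => exact le_rfl
  | succ m ih =>
    refine (ih _ _).trans (residualIdeal_mono ?_ _)
    rw [Ideal.map_sup, Ideal.map_span, Set.image_singleton]
    refine sup_le_sup_right (Ideal.map_le_iff_le_comap.mpr ?_) _
    rintro s ⟨k, hk⟩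
    refine ⟨k, ?_⟩
    have := Ideal.mem_map_of_mem f hk
    rwa [map_mul, map_pow] at this

/-- If `residualIdeal I g` has no nonzero element satisfying `Q`, then `g` satisfies modulo `I` no
polynomial relation with coefficients satisfying `Q`. -/
theorem eq_zero_of_eval_mem {R : Type*} [CommRing R] {Q : R → Prop} {m : ℕ} {I : Ideal R}
    {g : Fin m → R} (hQ : ∀ f ∈ residualIdeal I g, Q f → f = 0) (h : MvPolynomial (Fin m) R)
    (hh : ∀ e, Q (coeff e h)) (hI : eval g h ∈ I) : h = 0 := by
  induction m generalizing I with
  | zero =>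
    obtain ⟨c, rfl⟩ := C_surjective (Fin 0) h
    have h0 := hh 0
    rw [coeff_zero_C] at h0
    rw [eval_C] at hI
    rw [hQ c hI h0, C_0]
  | succ m ih =>
    by_contra h0
    set p := finSuccEquiv R m h with hp
    have hp0 : p ≠ 0 := by
      rw [hp]
      simpa using h0
    obtain ⟨q, hq⟩ := Polynomial.X_pow_dvd_iff.mpr
      fun d (hd : d < p.natTrailingDegree) => Polynomial.coeff_eq_zero_of_lt_natTrailingDegree hd
    have hq0 : q.coeff 0 = p.coeff p.natTrailingDegree := by
      have h1 := congrArg (Polynomial.coeff · p.natTrailingDegree) hq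
      simp only [Polynomial.coeff_X_pow_mul', le_refl, if_true, Nat.sub_self] at h1
      exact h1.symm
    have hne : q.coeff 0 ≠ 0 := by
      rw [hq0]
      exact Polynomial.trailingCoeff_nonzero_iff_nonzero.mpr hp0
    refine hne (ih hQ _ (fun e => ?_) ?_)
    · rw [hq0, hp, finSuccEquiv_coeff_coeff]
      exact hh _
    · have h1 : eval g h = g 0 ^ p.natTrailingDegree *
          Polynomial.eval (g 0) (q.map (eval (Fin.tail g))) := by
        conv_lhs => rw [← Fin.cons_self_tail g]
        rw [eval_eq_eval_mv_eval', ← hp]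
        conv_lhs => rw [hq]
        simp
      have h2 : Polynomial.eval (g 0) (q.map (eval (Fin.tail g))) ∈ saturation I (g 0) :=
        ⟨_, h1 ▸ hI⟩
      rw [← Polynomial.divX_mul_X_add q] at h2
      simp only [Polynomial.map_add, Polynomial.map_mul, Polynomial.map_X, Polynomial.map_C,
        Polynomial.eval_add, Polynomial.eval_mul, Polynomial.eval_X, Polynomial.eval_C] at h2
      set y := Polynomial.eval (g 0) (q.divX.map (eval (Fin.tail g)))
      have h3 : eval (Fin.tail g) (q.coeff 0) =
          (y * g 0 + eval (Fin.tail g) (q.coeff 0)) - y * g 0 := by ring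
      rw [h3]
      refine Ideal.sub_mem _ (Ideal.mem_sup_left h2) (Ideal.mem_sup_right ?_)
      exact Ideal.mul_mem_left _ _ (Ideal.subset_span rfl)

/-- An element of the residual ideal becomes highly divisible by `τ` in every domain in which the
`g j` become powers of `τ` with suitable exponents. -/
theorem exists_weights_of_mem_residualIdeal {R : Type*} [CommRing R] {m : ℕ} {I : Ideal R}
    {g : Fin m → R} {h : R} (hh : h ∈ residualIdeal I g) (N : ℕ) :
    ∃ w : Fin m → ℕ, (∀ j, 0 < w j) ∧ ∃ a ∈ I, ∃ N' : ℕ, ∀ q : Ideal R, q.IsPrime →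
      ∀ t : R ⧸ q, t ≠ 0 → (∀ j, Ideal.Quotient.mk q (g j) = t ^ w j) →
        t ^ N' ∣ Ideal.Quotient.mk q a → t ^ N ∣ Ideal.Quotient.mk q h := by
  induction m generalizing I with
  | zero => exact ⟨Fin.elim0, fun j => j.elim0, h, hh, N, fun q _ t _ _ hd => hd⟩
  | succ m ih =>
    obtain ⟨w, hw, a₁, ha₁, N₁, hN₁⟩ := ih (g := Fin.tail g) hh
    obtain ⟨s, ⟨k, hk⟩, y, hy, rfl⟩ := Submodule.mem_sup.mp ha₁
    obtain ⟨r, rfl⟩ := Ideal.mem_span_singleton'.mp hy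
    refine ⟨Fin.cons (N₁ + 1) w, Fin.cases (Nat.succ_pos _) hw, _, hk, (N₁ + 1) * k + N₁,
      fun q hq t ht hg hd => hN₁ q hq t ht (fun j => hg j.succ) ?_⟩
    have h0 : Ideal.Quotient.mk q (g 0) = t ^ (N₁ + 1) := hg 0
    rw [map_mul, map_pow, h0, ← pow_mul, pow_add] at hd
    rw [map_add, map_mul, h0]
    refine dvd_add ((mul_dvd_mul_iff_left (pow_ne_zero _ ht)).mp hd) (Dvd.dvd.mul_left ?_ _)
    exact pow_dvd_pow _ (Nat.le_succ _)

/-- A prime minimal over an ideal, and whose height is the number of generators, contains the prime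
of a curve along which the generators are prescribed monomials in a parameter. -/
theorem exists_prime_of_weights {R : Type*} [CommRing R] [IsNoetherianRing R] {m k : ℕ}
    {g : Fin m → R} {f : Fin (k + 1) → R} {M : Ideal R}
    (hM : M ∈ (Ideal.span (Set.range g ∪ Set.range f)).minimalPrimes)
    (hh : ((m + (k + 1) : ℕ) : ℕ∞) ≤ M.height) {c : Fin (k + 1) → R} (hc : c 0 = 1)
    {w : Fin m → ℕ} (hw : ∀ j, 0 < w j) :
    ∃ q : Ideal R, q.IsPrime ∧ q ≤ M ∧ f 0 ∉ q ∧ (∀ i, f i - c i * f 0 ∈ q) ∧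
      ∀ j, g j - f 0 ^ w j ∈ q := by
  have hMp : M.IsPrime := hM.1.1
  have hM2 := Ideal.span_le.mp hM.1.2
  set u : Fin m → R := fun j => g j - f 0 ^ w j with hu
  set v : Fin k → R := fun i => f i.succ - c i.succ * f 0 with hv
  have hle : Ideal.span (Set.range u ∪ Set.range v) ≤ M := by
    rw [Ideal.span_le, Set.union_subset_iff]
    constructor
    · rintro _ ⟨j, rfl⟩
      exact M.sub_mem (hM2 (Or.inl ⟨_, rfl⟩)) (M.pow_mem_of_mem (hM2 (Or.inr ⟨_, rfl⟩)) _ (hw j))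
    · rintro _ ⟨i, rfl⟩
      exact M.sub_mem (hM2 (Or.inr ⟨_, rfl⟩)) (M.mul_mem_left _ (hM2 (Or.inr ⟨_, rfl⟩)))
  obtain ⟨q, hq, hqM⟩ := Ideal.exists_minimalPrimes_le hle
  have hq2 := Ideal.span_le.mp hq.1.2
  have hall : ∀ i, f i - c i * f 0 ∈ q := by
    refine Fin.cases ?_ fun i => hq2 (Or.inr ⟨i, rfl⟩)
    simp [hc]
  refine ⟨q, hq.1.1, hqM, fun h0 => ?_, hall, fun j => hq2 (Or.inl ⟨j, rfl⟩)⟩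
  have hMq : M ≤ q := by
    refine hM.2 ⟨hq.1.1, ?_⟩ hqM
    rw [Ideal.span_le, Set.union_subset_iff]
    constructor
    · rintro _ ⟨j, rfl⟩
      simpa [hu] using q.add_mem (hq2 (Or.inl ⟨j, rfl⟩)) (q.pow_mem_of_mem h0 _ (hw j))
    · rintro _ ⟨i, rfl⟩
      simpa using q.add_mem (hall i) (q.mul_mem_left (c i) h0)
  have h1 := Ideal.height_le_card_of_mem_minimalPrimes_span
    ((Set.finite_range u).union (Set.finite_range v)) hq
  have h2 : (Set.range u ∪ Set.range v).ncard ≤ m + k := by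
    refine (Set.ncard_union_le _ _).trans (Nat.add_le_add ?_ ?_)
    · rw [← Set.image_univ]
      simpa using Set.ncard_image_le (f := u) Set.finite_univ
    · rw [← Set.image_univ]
      simpa using Set.ncard_image_le (f := v) Set.finite_univ
  rw [le_antisymm hqM hMq] at h1
  have := Nat.cast_le.mp (hh.trans (h1.trans (Nat.cast_le.mpr h2)))
  omega

/-- A weak form of quasi-regularity of a system of parameters. -/
theorem coeff_mem_of_eval_mem {K R : Type*} [Field K] [Infinite K] [CommRing R]
    [IsNoetherianRing R] [Algebra K R] {m k : ℕ} {g : Fin m → R} {f : Fin (k + 1) → R} {M : Ideal R}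
    (hM : M ∈ (Ideal.span (Set.range g ∪ Set.range f)).minimalPrimes)
    (hh : ((m + (k + 1) : ℕ) : ℕ∞) ≤ M.height) {h : MvPolynomial (Fin (k + 1)) R}
    (hmem : eval f h ∈ residualIdeal ⊥ g)
    {d : ℕ} (hd : ∀ e : Fin (k + 1) →₀ ℕ, e.degree < d → coeff e h = 0)
    {e : Fin (k + 1) →₀ ℕ} (he : e.degree = d) : coeff e h ∈ M := by
  have hMp : M.IsPrime := hM.1.1
  obtain ⟨w, hw, a, ha, N, hN⟩ := exists_weights_of_mem_residualIdeal hmem (d + 1)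
  obtain rfl : a = 0 := ha
  have hdir : ∀ v : Fin (k + 1) → K, v 0 ≠ 0 →
      eval (fun i => algebraMap K R (v i / v 0)) (homogeneousComponent d h) ∈ M := by
    intro v hv
    obtain ⟨q, hq, hqM, hf0, hfq, hgq⟩ := exists_prime_of_weights hM hh
      (c := fun i => algebraMap K R (v i / v 0)) (by simp [div_self hv]) hw
    obtain ⟨r, hr⟩ := exists_eval_const_mul h hd (f 0) fun i => algebraMap K R (v i / v 0)
    set y := eval (fun i => algebraMap K R (v i / v 0)) (homogeneousComponent d h)
    have h1 : Ideal.Quotient.mk q (eval f h) = Ideal.Quotient.mk q (f 0 ^ d * (y + f 0 * r)) := by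
      rw [← hr, map_eval, map_eval]
      congr 2
      ext i
      rw [Function.comp_apply, Function.comp_apply, Ideal.Quotient.eq, mul_comm (f 0)]
      exact hfq i
    have ht : Ideal.Quotient.mk q (f 0) ≠ 0 := by
      rwa [Ne, Ideal.Quotient.eq_zero_iff_mem]
    have h2 := hN q hq (Ideal.Quotient.mk q (f 0)) ht
      (fun j => by rw [← map_pow, Ideal.Quotient.eq]; exact hgq j) (by simp)
    rw [h1, map_mul, map_pow, pow_succ, mul_dvd_mul_iff_left (pow_ne_zero _ ht)] at h2
    obtain ⟨z, hz⟩ := h2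
    obtain ⟨z, rfl⟩ := Ideal.Quotient.mk_surjective z
    rw [← map_mul, Ideal.Quotient.eq] at hz
    have hf0M : f 0 ∈ M := hM.1.2 (Ideal.subset_span (Or.inr ⟨0, rfl⟩))
    have h3 : y = (y + f 0 * r - f 0 * z) - f 0 * r + f 0 * z := by ring
    rw [h3]
    exact M.add_mem (M.sub_mem (hqM hz) (M.mul_mem_right _ hf0M)) (M.mul_mem_right _ hf0M)
  let φ := Ideal.Quotient.mk M
  have hzero : map φ (homogeneousComponent d h) = 0 := by
    have hinj : Function.Injective (algebraMap K (R ⧸ M)) := (algebraMap K (R ⧸ M)).injective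
    refine funext_set (fun _ => algebraMap K (R ⧸ M) '' {0}ᶜ) (fun _ => ?_) fun x hx => ?_
    · exact (Set.finite_singleton 0).infinite_compl.image hinj.injOn
    choose v hv hvx using fun i => hx i trivial
    have h0 : v 0 ≠ 0 := hv 0
    have hx2 : x = fun i => algebraMap K (R ⧸ M) (v 0) * φ (algebraMap K R (v i / v 0)) := by
      ext i
      rw [← hvx i]
      change _ = _ * algebraMap K (R ⧸ M) _
      rw [← map_mul, mul_div_cancel₀ _ h0]
    rw [hx2, ((homogeneousComponent_isHomogeneous d h).map φ).eval_const_mul]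
    have h5 := hdir v h0
    rw [← Ideal.Quotient.eq_zero_iff_mem, map_eval] at h5
    exact (congrArg _ h5).trans (by rw [mul_zero, map_zero])
  have h6 := congrArg (coeff e) hzero
  rw [coeff_map, coeff_homogeneousComponent, if_pos he, coeff_zero] at h6
  exact Ideal.Quotient.eq_zero_iff_mem.mp h6

/-- The standard monomials of an ideal with respect to the degree lexicographic order. -/
def stdMonomials {n : ℕ} {K : Type*} [Field K] (J : Ideal (MvPolynomial (Fin n) K)) :
    Set (Fin n →₀ ℕ) :=
  {u | ∀ f ∈ J, f ≠ 0 → ¬ MonomialOrder.degLex.degree f ≤ u}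

theorem isLowerSet_stdMonomials {n : ℕ} {K : Type*} [Field K]
    (J : Ideal (MvPolynomial (Fin n) K)) : IsLowerSet (stdMonomials J) :=
  fun _ _ hba ha f hf hf0 hle => ha f hf hf0 (hle.trans hba)

theorem eq_zero_of_support_subset_stdMonomials {n : ℕ} {K : Type*} [Field K]
    {J : Ideal (MvPolynomial (Fin n) K)} {f : MvPolynomial (Fin n) K} (hf : f ∈ J)
    (hs : ∀ u ∈ f.support, u ∈ stdMonomials J) : f = 0 := by
  by_contra h0
  exact hs _ (MonomialOrder.degLex.degree_mem_support h0) f hf h0 le_rfl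

theorem exists_standard_remainder {n : ℕ} {K : Type*} [Field K]
    (J : Ideal (MvPolynomial (Fin n) K)) (f : MvPolynomial (Fin n) K) :
    ∃ r, f - r ∈ J ∧ (∀ u ∈ r.support, u ∈ stdMonomials J) ∧ r.totalDegree ≤ f.totalDegree := by
  obtain ⟨g, r, hf, hdeg, hr⟩ := MonomialOrder.degLex.div_set
    (B := {b | b ∈ J ∧ b ≠ 0}) (fun b hb => by
      rw [isUnit_iff_ne_zero]
      exact MonomialOrder.leadingCoeff_ne_zero_iff.mpr hb.2) f
  have hsub : f - r = Finsupp.linearCombination (MvPolynomial (Fin n) K)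
      (fun b : {b | b ∈ J ∧ b ≠ 0} => (b : MvPolynomial (Fin n) K)) g :=
    sub_eq_of_eq_add hf
  refine ⟨r, ?_, fun u hu b hb hb0 => hr u hu b ⟨hb, hb0⟩, ?_⟩
  · rw [hsub, Finsupp.linearCombination_apply]
    exact J.sum_mem fun b _ => J.mul_mem_left _ b.2.1
  · have h1 : (f - r).totalDegree ≤ f.totalDegree := by
      rw [hsub, Finsupp.linearCombination_apply]
      refine totalDegree_finsetSum_le fun b _ => ?_
      refine (congrArg totalDegree (mul_comm _ _)).trans_le ?_
      exact degLex_totalDegree_monotone (hdeg b)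
    have h2 : r = f - (f - r) := by ring
    rw [h2]
    exact (totalDegree_sub _ _).trans (max_le le_rfl h1)

theorem card_le_card_of_linearIndependent_of_mem_span {K V ι κ : Type*} [Field K] [AddCommGroup V]
    [Module K V] [Fintype ι] {v : ι → V} (hv : LinearIndependent K v) (B : Finset κ) (w : κ → V)
    (h : ∀ i, v i ∈ Submodule.span K (w '' B)) : Fintype.card ι ≤ B.card := by
  classical
  have h1 : Submodule.span K (Set.range v) ≤ Submodule.span K ((B.image w : Finset V) : Set V) := by
    rw [Submodule.span_le, Finset.coe_image]
    rintro _ ⟨i, rfl⟩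
    exact h i
  rw [← finrank_span_eq_card hv]
  exact (Submodule.finrank_mono h1).trans ((finrank_span_finset_le_card _).trans
    Finset.card_image_le)

/-- If the polynomials `g` satisfy no relation whose coefficients are supported on `T`, then the
products of monomials in `T` and in `g` are few. -/
theorem card_le_of_no_relation {n m : ℕ} {K : Type*} [Field K] {T : Set (Fin n →₀ ℕ)}
    {b : Fin m → ℕ} {g : Fin m → MvPolynomial (Fin n) K} (hg : ∀ j, (g j).totalDegree ≤ b j)
    (hT : ∀ h : MvPolynomial (Fin m) (MvPolynomial (Fin n) K),
      (∀ e, ∀ u ∈ (coeff e h).support, u ∈ T) → eval g h = 0 → h = 0)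
    {E : ℕ} {A : Finset ((Fin n →₀ ℕ) × (Fin m →₀ ℕ))}
    (hA : ∀ a ∈ A, a.1 ∈ T ∧ a.1.degree + ∑ j, b j * a.2 j ≤ E)
    {B : Finset (Fin n →₀ ℕ)} (hB : ∀ u : Fin n →₀ ℕ, u.degree ≤ E → u ∈ B) :
    A.card ≤ B.card := by
  classical
  rw [← Fintype.card_coe A]
  let v : A → MvPolynomial (Fin n) K := fun a => monomial a.1.1 1 * ∏ j, g j ^ a.1.2 j
  have hv : LinearIndependent K v := by
    rw [Fintype.linearIndependent_iff]
    intro c hc a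
    let h : MvPolynomial (Fin m) (MvPolynomial (Fin n) K) :=
      ∑ a : A, monomial a.1.2 (monomial a.1.1 (c a))
    have hcoeff : ∀ e u, coeff u (coeff e h) =
        ∑ a : A, if a.1.2 = e ∧ a.1.1 = u then c a else 0 := by
      intro e u
      simp only [h, coeff_sum, coeff_monomial]
      refine Finset.sum_congr rfl fun a _ => ?_
      by_cases h1 : a.1.2 = e <;> simp [h1, coeff_monomial]
    have hh : h = 0 := by
      refine hT h (fun e u hu => ?_) ?_
      · rw [mem_support_iff, hcoeff] at hu
        obtain ⟨a, -, ha⟩ := Finset.exists_ne_zero_of_sum_ne_zero hu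
        have h1 : a.1.2 = e ∧ a.1.1 = u := by
          by_contra h1
          exact ha (if_neg h1)
        exact h1.2 ▸ (hA a a.2).1
      · rw [← hc, map_sum]
        refine Finset.sum_congr rfl fun a _ => ?_
        rw [eval_monomial, Finsupp.prod_fintype _ _ fun _ => pow_zero _, ← smul_mul_assoc,
          smul_monomial, smul_eq_mul, mul_one]
    have h2 := hcoeff a.1.2 a.1.1
    rw [hh, coeff_zero, coeff_zero, Finset.sum_eq_single a, if_pos ⟨rfl, rfl⟩] at h2
    · exact h2.symm
    · intro a' _ hne
      refine if_neg fun h3 => hne (Subtype.ext (Prod.ext h3.2 h3.1))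
    · simp
  refine card_le_card_of_linearIndependent_of_mem_span hv B (fun u => monomial u (1 : K))
    fun a => ?_
  have hdeg : (v a).totalDegree ≤ E := by
    refine (totalDegree_mul _ _).trans (le_trans (Nat.add_le_add ?_ ?_) (hA a a.2).2)
    · exact (totalDegree_monomial_le _ _).trans le_rfl
    · refine (totalDegree_finsetProd _ _).trans (Finset.sum_le_sum fun j _ => ?_)
      refine (totalDegree_pow _ _).trans ?_
      rw [mul_comm]
      exact Nat.mul_le_mul_right _ (hg j)
  rw [(v a).as_sum]
  refine Submodule.sum_mem _ fun u hu => ?_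
  have : monomial u (coeff u (v a)) = coeff u (v a) • monomial u (1 : K) := by
    rw [smul_monomial, smul_eq_mul, mul_one]
  rw [this]
  refine Submodule.smul_mem _ _ (Submodule.subset_span ⟨u, hB u ?_, rfl⟩)
  exact (le_totalDegree hu).trans hdeg

theorem mul_mem_restrictSupport_le {K σ : Type*} [Field K] {φ : (σ →₀ ℕ) →+ ℤ} {s t : ℤ}
    {f g : MvPolynomial σ K} (hf : f ∈ restrictSupport K {d | φ d ≤ s})
    (hg : g ∈ restrictSupport K {d | φ d ≤ t}) : f * g ∈ restrictSupport K {d | φ d ≤ s + t} := by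
  have h := Submodule.mul_mem_mul hf hg
  rw [← restrictSupport_add] at h
  refine restrictSupport_mono K ?_ h
  rintro _ ⟨a, ha, b, hb, rfl⟩
  exact (map_add φ a b).trans_le (add_le_add ha hb)

theorem one_mem_restrictSupport_le {K σ : Type*} [Field K] {φ : (σ →₀ ℕ) →+ ℤ} :
    (1 : MvPolynomial σ K) ∈ restrictSupport K {d | φ d ≤ 0} :=
  (monomial_mem_restrictSupport (m := 0) (r := 1)).mpr (Or.inl (map_zero φ).le)

theorem prod_pow_mem_restrictSupport_le {K σ ι : Type*} [Field K] {φ : (σ →₀ ℕ) →+ ℤ} {s : ℤ}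
    {f : ι → MvPolynomial σ K} (hf : ∀ i, f i ∈ restrictSupport K {d | φ d ≤ s}) (I : Finset ι)
    (e : ι → ℕ) :
    ∏ i ∈ I, f i ^ e i ∈ restrictSupport K {d | φ d ≤ (∑ i ∈ I, e i : ℕ) * s} := by
  classical
  have hpow : ∀ i (r : ℕ), f i ^ r ∈ restrictSupport K {d | φ d ≤ r * s} := by
    intro i r
    induction r with
    | zero => simpa using one_mem_restrictSupport_le
    | succ r ih =>
      rw [pow_succ, Nat.cast_succ, add_one_mul]
      exact mul_mem_restrictSupport_le ih (hf i)
  induction I using Finset.induction_on with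
  | empty => simpa using one_mem_restrictSupport_le
  | insert i I hi ih =>
    rw [Finset.prod_insert hi, Finset.sum_insert hi, Nat.cast_add, add_mul]
    exact mul_mem_restrictSupport_le (hpow i _) ih

theorem rename_inl_mem_restrictSupport {K α β : Type*} [Field K] {p : α → ℤ} {q : β → ℤ} {s : ℤ}
    {f : MvPolynomial α K} (hf : ∀ d ∈ f.support, Finsupp.weight p d ≤ s) :
    rename Sum.inl f ∈ restrictSupport K {d | Finsupp.weight (Sum.elim p q) d ≤ s} := by
  classical
  refine (mem_restrictSupport_iff _).mpr fun d hd => ?_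
  rw [Finset.mem_coe, support_rename_of_injective Sum.inl_injective, Finset.mem_image] at hd
  obtain ⟨d, hd, rfl⟩ := hd
  have h : Finsupp.weight (Sum.elim p q) (Finsupp.mapDomain Sum.inl d) = Finsupp.weight p d := by
    rw [Finsupp.weight_apply, Finsupp.weight_apply, Finsupp.sum_mapDomain_index] <;>
      simp [add_mul]
  exact h.trans_le (hf d hd)

theorem weight_one_le_of_totalDegree_le {K α : Type*} [Field K] {f : MvPolynomial α K} {s : ℕ}
    (hf : f.totalDegree ≤ s) : ∀ d ∈ f.support, Finsupp.weight (1 : α → ℤ) d ≤ s := by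
  intro d hd
  have h : Finsupp.weight (1 : α → ℤ) d = (d.sum fun _ e => e : ℕ) := by
    simp [Finsupp.weight_apply, Finsupp.sum]
  rw [h]
  exact_mod_cast (le_totalDegree hd).trans hf

theorem totalDegree_pderiv_le {K α : Type*} [Field K] (f : MvPolynomial α K) (i : α) :
    (pderiv i f).totalDegree ≤ f.totalDegree := by
  conv_lhs => rw [f.as_sum, map_sum]
  refine totalDegree_finsetSum_le fun d hd => ?_
  rw [pderiv_monomial]
  refine (totalDegree_monomial_le _ _).trans (le_trans ?_ (le_totalDegree hd))
  change (d - Finsupp.single i 1).degree ≤ d.degree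
  exact Finsupp.degree_mono tsub_le_self

/-- The multi-indices of degree at most `t`. -/
noncomputable def degreeLE (n t : ℕ) : Finset (Fin n →₀ ℕ) :=
  (Finset.univ.finsuppAntidiag t : Finset (Fin (n + 1) →₀ ℕ)).image Finsupp.tail

theorem mem_finsuppAntidiag_univ {ι : Type*} [Fintype ι] [DecidableEq ι] {t : ℕ} {e : ι →₀ ℕ} :
    e ∈ Finset.univ.finsuppAntidiag t ↔ ∑ i, e i = t := by
  simp [Finset.mem_finsuppAntidiag]

theorem mem_degreeLE {n t : ℕ} {u : Fin n →₀ ℕ} : u ∈ degreeLE n t ↔ u.degree ≤ t := by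
  rw [degreeLE, Finset.mem_image, Finsupp.degree_eq_sum]
  constructor
  · rintro ⟨e, he, rfl⟩
    rw [mem_finsuppAntidiag_univ, Fin.sum_univ_succ] at he
    simp only [Finsupp.tail_apply]
    omega
  · intro hu
    refine ⟨Finsupp.cons (t - ∑ i, u i) u, ?_, Finsupp.tail_cons _ _⟩
    rw [mem_finsuppAntidiag_univ, Fin.sum_univ_succ]
    simp only [Finsupp.cons_zero, Finsupp.cons_succ]
    omega

theorem card_degreeLE (n t : ℕ) : (degreeLE n t).card = (t + n).choose n := by
  rw [degreeLE, Finset.card_image_of_injOn, Finset.card_finsuppAntidiag_nat_eq_choose]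
  · rw [Finset.card_univ, Fintype.card_fin, Nat.add_right_comm, Nat.add_sub_cancel,
      add_comm t n, Nat.choose_symm_add]
  · intro d hd e he hde
    rw [Finset.mem_coe, mem_finsuppAntidiag_univ, Fin.sum_univ_succ] at hd he
    have h : ∀ i : Fin n, d i.succ = e i.succ := fun i => DFunLike.congr_fun hde i
    ext i
    refine Fin.cases ?_ h i
    simp only [h] at hd
    omega

open Classical in
/-- The number of elements of `T` of degree at most `t`. -/
noncomputable def countLE {n : ℕ} (T : Set (Fin n →₀ ℕ)) (t : ℕ) : ℕ :=
  ((degreeLE n t).filter (· ∈ T)).card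

/-- Over an isolated common zero, the polynomials separating the points and the monomials in `P`
are independent modulo the residual ideal of `G`. -/
theorem eq_zero_of_eval_mem_residualIdeal {K τ : Type*} [Field K] [IsAlgClosed K] [Finite τ]
    {m k : ℕ} (hk : Nat.card τ = m) {G : Fin m → MvPolynomial (Fin (k + 1) ⊕ τ) K}
    {P : Fin (k + 1) → MvPolynomial (Fin (k + 1) ⊕ τ) K}
    (hfin : (zeroLocus K (Ideal.span (Set.range G ∪ Set.range P))).Finite)
    {X : Finset (Fin (k + 1) → K)}
    (hX : ∀ x ∈ X, ∃ l, Sum.elim x l ∈ zeroLocus K (Ideal.span (Set.range G ∪ Set.range P)))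
    {e : (Fin (k + 1) → K) → MvPolynomial (Fin (k + 1)) K} (he : ∀ x ∈ X, eval x (e x) ≠ 0)
    (he' : ∀ x ∈ X, ∀ y ∈ X, y ≠ x → eval x (e y) = 0)
    {h : MvPolynomial (Fin (k + 1)) (MvPolynomial (Fin (k + 1) ⊕ τ) K)}
    {c : (Fin (k + 1) → K) → (Fin (k + 1) →₀ ℕ) → K}
    (hc : ∀ a, coeff a h = ∑ x ∈ X, C (c x a) * rename Sum.inl (e x))
    (hmem : eval P h ∈ residualIdeal ⊥ G) {x : Fin (k + 1) → K} (hx : x ∈ X)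
    (a : Fin (k + 1) →₀ ℕ) : c x a = 0 := by
  induction hd : a.degree using Nat.strong_induction_on generalizing a x with
  | _ d ih =>
    obtain ⟨l, hl⟩ := hX x hx
    have hlow : ∀ a : Fin (k + 1) →₀ ℕ, a.degree < d → coeff a h = 0 := by
      intro a ha
      rw [hc]
      refine Finset.sum_eq_zero fun y hy => ?_
      rw [ih _ ha hy a rfl, C_0, zero_mul]
    have hcoeff := coeff_mem_of_eval_mem (K := K)
      (vanishingIdeal_singleton_mem_minimalPrimes hfin hl)
      (le_trans (by simp [hk, add_comm]) (height_vanishingIdeal_singleton _)) hmem hlow hd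
    rw [hc, mem_vanishingIdeal_singleton_iff, map_sum, Finset.sum_eq_single x] at hcoeff
    · rw [map_mul, ← algebraMap_eq, AlgHom.commutes, aeval_rename, Sum.elim_comp_inl] at hcoeff
      exact (mul_eq_zero.mp hcoeff).resolve_right (by simpa using he x hx)
    · intro y hy hyx
      rw [map_mul, aeval_rename, Sum.elim_comp_inl]
      exact mul_eq_zero_of_right _ (by simpa using he' x hx y hy hyx)
    · exact fun h => absurd hx h

theorem exists_separating_polynomials {K σ : Type*} [Field K] (X : Finset (σ → K)) :
    ∃ e : (σ → K) → MvPolynomial σ K, (∀ x ∈ X, eval x (e x) ≠ 0) ∧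
      ∀ x ∈ X, ∀ y ∈ X, y ≠ x → eval x (e y) = 0 := by
  classical
  have h : ∀ x y : σ → K, x ≠ y → ∃ p : MvPolynomial σ K, eval x p ≠ 0 ∧ eval y p = 0 := by
    intro x y hxy
    obtain ⟨i, hi⟩ := Function.ne_iff.mp hxy
    exact ⟨MvPolynomial.X i - C (y i), by simpa [sub_eq_zero] using hi, by simp⟩
  choose p hp hp' using h
  refine ⟨fun x => ∏ y ∈ X, if hxy : x ≠ y then p x y hxy else 1, fun x _ => ?_,
    fun x hx y _ hyx => ?_⟩
  · rw [map_prod, Finset.prod_ne_zero_iff]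
    intro y _
    split_ifs with hxy
    · exact hp x y hxy
    · simp
  · rw [map_prod]
    refine Finset.prod_eq_zero hx ?_
    rw [dif_pos hyx]
    exact hp' y x hyx

theorem mk_monomial_mem_span {K : Type*} [Field K] {m n : ℕ} (J : Ideal (MvPolynomial (Fin n) K))
    {A c D : ℕ} {b : Fin m → ℕ} {d : Fin n ⊕ Fin m →₀ ℕ}
    (hd₁ : Finsupp.weight (Sum.elim 0 1 : Fin n ⊕ Fin m → ℤ) d ≤ D)
    (hd₂ : Finsupp.weight (Sum.elim 1 (fun j => (A : ℤ) - b j) : Fin n ⊕ Fin m → ℤ) d ≤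
      c + D * A)
    {B : Finset ((Fin n →₀ ℕ) × (Fin (m + 1) →₀ ℕ))}
    (hB : ∀ u (γ : Fin (m + 1) →₀ ℕ), u ∈ stdMonomials J → ∑ t, γ t = D →
      u.degree ≤ c + ∑ t, Fin.cons (α := fun _ => ℕ) A b t * γ t → (u, γ) ∈ B) :
    Ideal.Quotient.mk (J.map (rename (R := K) (Sum.inl : Fin n → Fin n ⊕ Fin m))) (monomial d 1) ∈
      Submodule.span K ((fun p : (Fin n →₀ ℕ) × (Fin (m + 1) →₀ ℕ) =>
        Ideal.Quotient.mk (J.map (rename (R := K) Sum.inl))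
        (rename Sum.inl (monomial p.1 1) * rename Sum.inr (monomial p.2.tail 1))) '' B) := by
  obtain ⟨u₀, γ₀, rfl⟩ : ∃ u₀ γ₀, d = Finsupp.sumElim u₀ γ₀ :=
    ⟨_, _, (Finsupp.comapDomain_sumElim_comapDomain d).symm⟩
  have hw : ∀ (w : Fin n ⊕ Fin m → ℤ) (d : Fin n ⊕ Fin m →₀ ℕ),
      Finsupp.weight w d = ∑ i, d i • w i := fun w d => by
    rw [Finsupp.weight_apply]
    exact Finsupp.sum_fintype _ _ fun _ => zero_smul _ _
  simp only [hw, Fintype.sum_sum_type, Finsupp.sumElim_inl, Finsupp.sumElim_inr, Sum.elim_inl,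
    Sum.elim_inr,
    Pi.zero_apply, Pi.one_apply, mul_zero, Finset.sum_const_zero, zero_add, nsmul_eq_mul,
    mul_one, mul_sub, Finset.sum_sub_distrib] at hd₁ hd₂
  have hmon : (monomial (Finsupp.sumElim u₀ γ₀) 1 : MvPolynomial (Fin n ⊕ Fin m) K) =
      rename Sum.inl (monomial u₀ 1) * rename Sum.inr (monomial γ₀ 1) := by
    rw [rename_monomial, rename_monomial, monomial_mul, one_mul]
    refine congrArg (monomial · (1 : K)) (Finsupp.ext ?_)
    rintro (i | j)
    · simp [Finsupp.mapDomain_apply Sum.inl_injective, Finsupp.mapDomain_of_notMem_range]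
    · simp [Finsupp.mapDomain_apply Sum.inr_injective, Finsupp.mapDomain_of_notMem_range]
  obtain ⟨r, hrJ, hrT, hrdeg⟩ := exists_standard_remainder J (monomial u₀ (1 : K))
  have hmk : Ideal.Quotient.mk (J.map (rename (R := K) (Sum.inl : Fin n → Fin n ⊕ Fin m)))
      (monomial (Finsupp.sumElim u₀ γ₀) 1) =
      Ideal.Quotient.mk _ (rename Sum.inl r * rename Sum.inr (monomial γ₀ 1)) := by
    rw [hmon, Ideal.Quotient.eq, ← sub_mul, ← map_sub]
    exact Ideal.mul_mem_right _ _ (Ideal.mem_map_of_mem _ hrJ)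
  rw [hmk, r.as_sum, map_sum, Finset.sum_mul, map_sum]
  refine Submodule.sum_mem _ fun u hu => ?_
  have hsm : monomial u (coeff u r) = coeff u r • monomial u (1 : K) := by
    rw [smul_monomial, smul_eq_mul, mul_one]
  rw [hsm, map_smul, smul_mul_assoc]
  suffices h : Ideal.Quotient.mk (J.map (rename (R := K) (Sum.inl : Fin n → Fin n ⊕ Fin m)))
      (rename Sum.inl (monomial u 1) * rename Sum.inr (monomial γ₀ 1)) ∈ _ from
    Submodule.smul_mem _ (coeff u r) h
  refine Submodule.subset_span ⟨(u, Finsupp.cons (D - ∑ j, γ₀ j) γ₀), hB _ _ (hrT u hu) ?_ ?_, ?_⟩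
  · rw [Fin.sum_univ_succ]
    simp only [Finsupp.cons_zero, Finsupp.cons_succ]
    have : ∑ j, γ₀ j ≤ D := by exact_mod_cast hd₁
    omega
  · rw [Fin.sum_univ_succ]
    simp only [Finsupp.cons_zero, Finsupp.cons_succ, Fin.cons_zero, Fin.cons_succ]
    have h1 : u.degree ≤ ∑ i, u₀ i := by
      have h2 : u.degree ≤ r.totalDegree := le_totalDegree hu
      refine h2.trans (hrdeg.trans ((totalDegree_monomial_le _ _).trans ?_))
      exact (Finsupp.degree_eq_sum u₀).le
    refine h1.trans ?_
    have h3 : ∑ j, γ₀ j ≤ D := by exact_mod_cast hd₁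
    zify [h3]
    rw [← Finset.sum_mul] at hd₂
    have h4 : ∑ j, (b j : ℤ) * γ₀ j = ∑ j, (γ₀ j : ℤ) * b j :=
      Finset.sum_congr rfl fun _ _ => mul_comm _ _
    rw [h4]
    linarith
  · simp only [Finsupp.tail_cons]

theorem exists_card_mul_choose_le {K : Type*} [Field K] [IsAlgClosed K] {m k A : ℕ}
    {b : Fin m → ℕ} {F : Fin (k + 1) → MvPolynomial (Fin (k + 1)) K}
    (hF : ∀ i, (F i).totalDegree ≤ A) {g : Fin m → MvPolynomial (Fin (k + 1)) K}
    (hg : ∀ j, (g j).totalDegree ≤ b j)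
    {G : Fin m → MvPolynomial (Fin (k + 1) ⊕ Fin m) K} (hG : ∀ j, G j = rename Sum.inl (g j))
    {P : Fin (k + 1) → MvPolynomial (Fin (k + 1) ⊕ Fin m) K}
    (hP : ∀ i, P i = rename Sum.inl (F i) - ∑ j, X (Sum.inr j) * rename Sum.inl (pderiv i (g j)))
    (hfin : (zeroLocus K (Ideal.span (Set.range G ∪ Set.range P))).Finite)
    (Z : Finset (Fin (k + 1) → K))
    (hZ : ∀ x ∈ Z, ∃ l, Sum.elim x l ∈ zeroLocus K (Ideal.span (Set.range G ∪ Set.range P))) :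
    ∃ c : ℕ, ∀ D : ℕ, Z.card * (D + (k + 1)).choose (k + 1) ≤
      ∑ γ ∈ Finset.univ.finsuppAntidiag D, countLE (stdMonomials (residualIdeal ⊥ g))
        (c + ∑ t, Fin.cons (α := fun _ => ℕ) A b t * γ t) := by
  classical
  obtain ⟨e, he, he'⟩ := exists_separating_polynomials Z
  refine ⟨Z.sup fun x => (e x).totalDegree, fun D => ?_⟩
  set c := Z.sup fun x => (e x).totalDegree
  set J := residualIdeal ⊥ g
  let JR := J.map (rename (R := K) (Sum.inl : Fin (k + 1) → Fin (k + 1) ⊕ Fin m))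
  have hJR : JR ≤ residualIdeal ⊥ G := by
    refine (map_residualIdeal_le (rename Sum.inl : MvPolynomial _ K →ₐ[K] _).toRingHom
      ⊥ g).trans ?_
    rw [Ideal.map_bot]
    refine le_of_eq (congrArg _ (funext fun j => ?_))
    exact (hG j).symm
  have hP₁ : ∀ i, P i ∈ restrictSupport K
      {d | Finsupp.weight (Sum.elim 0 1 : Fin (k + 1) ⊕ Fin m → ℤ) d ≤ 1} := by
    intro i
    rw [hP]
    refine Submodule.sub_mem _ (rename_inl_mem_restrictSupport (by simp [Finsupp.weight_apply]))
      (Submodule.sum_mem _ fun j _ => ?_)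
    rw [← add_zero (1 : ℤ)]
    refine mul_mem_restrictSupport_le ?_
      (rename_inl_mem_restrictSupport (by simp [Finsupp.weight_apply]))
    exact (monomial_mem_restrictSupport _).mpr (Or.inl (by simp [Finsupp.weight_single]))
  have hP₂ : ∀ i, P i ∈ restrictSupport K
      {d | Finsupp.weight (Sum.elim 1 (fun j => (A : ℤ) - b j) : Fin (k + 1) ⊕ Fin m → ℤ) d ≤
        A} := by
    intro i
    rw [hP]
    refine Submodule.sub_mem _
      (rename_inl_mem_restrictSupport (weight_one_le_of_totalDegree_le (hF i)))
      (Submodule.sum_mem _ fun j _ => ?_)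
    rw [← sub_add_cancel (A : ℤ) (b j)]
    refine mul_mem_restrictSupport_le ?_ (rename_inl_mem_restrictSupport
      (weight_one_le_of_totalDegree_le ((totalDegree_pderiv_le _ _).trans (hg j))))
    exact (monomial_mem_restrictSupport _).mpr (Or.inl (by simp [Finsupp.weight_single]))
  let S := Z ×ˢ degreeLE (k + 1) D
  let B : Finset ((Fin (k + 1) →₀ ℕ) × (Fin (m + 1) →₀ ℕ)) :=
    ((Finset.univ.finsuppAntidiag D).sigma fun γ : Fin (m + 1) →₀ ℕ => (degreeLE (k + 1)
      (c + ∑ t, Fin.cons (α := fun _ => ℕ) A b t * γ t)).filter (· ∈ stdMonomials J)).image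
        fun p => (p.2, p.1)
  have hB : B.card ≤ ∑ γ ∈ Finset.univ.finsuppAntidiag D, countLE (stdMonomials J)
      (c + ∑ t, Fin.cons (α := fun _ => ℕ) A b t * γ t) := by
    refine Finset.card_image_le.trans ?_
    rw [Finset.card_sigma]
    exact Finset.sum_le_sum fun γ _ => le_of_eq (by rw [countLE])
  refine le_trans ?_ hB
  have hS : Z.card * (D + (k + 1)).choose (k + 1) = Fintype.card S := by
    rw [Fintype.card_coe, Finset.card_product, card_degreeLE]
  rw [hS]
  let v : (Fin (k + 1) → K) × (Fin (k + 1) →₀ ℕ) → MvPolynomial (Fin (k + 1) ⊕ Fin m) K :=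
    fun p => rename Sum.inl (e p.1) * ∏ i, P i ^ p.2 i
  have hv : LinearIndependent K fun p : S => Ideal.Quotient.mk JR (v p) := by
    rw [Fintype.linearIndependent_iff]
    intro a ha p
    let a' : (Fin (k + 1) → K) → (Fin (k + 1) →₀ ℕ) → K :=
      fun x α => if h : (x, α) ∈ S then a ⟨(x, α), h⟩ else 0
    let h : MvPolynomial (Fin (k + 1)) (MvPolynomial (Fin (k + 1) ⊕ Fin m) K) :=
      ∑ p ∈ S, monomial p.2 (C (a' p.1 p.2) * rename Sum.inl (e p.1))
    have hcoeff : ∀ α, coeff α h = ∑ x ∈ Z, C (a' x α) * rename Sum.inl (e x) := by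
      intro α
      simp only [h, S, coeff_sum, Finset.sum_product, coeff_monomial]
      refine Finset.sum_congr rfl fun x hx => ?_
      rw [Finset.sum_ite_eq']
      split_ifs with hα
      · rfl
      · have : a' x α = 0 := dif_neg fun h => hα (Finset.mem_product.mp h).2
        rw [this, C_0, zero_mul]
    have hmem : eval P h ∈ residualIdeal ⊥ G := by
      refine hJR (Ideal.Quotient.eq_zero_iff_mem.mp ?_)
      rw [← ha]
      simp only [h]
      rw [← Finset.sum_coe_sort S, map_sum, map_sum]
      refine Finset.sum_congr rfl fun p _ => ?_
      rw [eval_monomial, Finsupp.prod_fintype _ _ fun _ => pow_zero _, mul_assoc, ← smul_eq_C_mul]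
      have : a' p.1.1 p.1.2 = a p := dif_pos p.2
      rw [this]
      rfl
    have h0 := eq_zero_of_eval_mem_residualIdeal (by simp) hfin hZ he he' hcoeff hmem
      (Finset.mem_product.mp p.2).1 p.1.2
    rwa [show a' p.1.1 p.1.2 = a p from dif_pos p.2] at h0
  refine card_le_card_of_linearIndependent_of_mem_span hv B
    (fun p => Ideal.Quotient.mk JR
      (rename Sum.inl (monomial p.1 1) * rename Sum.inr (monomial p.2.tail 1))) fun p => ?_
  obtain ⟨hp₁, hp₂⟩ := Finset.mem_product.mp p.2
  rw [mem_degreeLE, Finsupp.degree_eq_sum] at hp₂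
  have hv₁ : v p ∈ restrictSupport K
      {d | Finsupp.weight (Sum.elim 0 1 : Fin (k + 1) ⊕ Fin m → ℤ) d ≤ D} := by
    have h := mul_mem_restrictSupport_le (rename_inl_mem_restrictSupport
      (f := e p.1.1) (s := 0) (p := 0) (by simp [Finsupp.weight_apply]))
      (prod_pow_mem_restrictSupport_le hP₁ Finset.univ p.1.2)
    refine restrictSupport_mono K (fun d hd => ?_) h
    refine (Set.mem_ofPred.mp hd).trans ?_
    rw [zero_add, mul_one]
    exact_mod_cast hp₂
  have hv₂ : v p ∈ restrictSupport K
      {d | Finsupp.weight (Sum.elim 1 (fun j => (A : ℤ) - b j) : Fin (k + 1) ⊕ Fin m → ℤ) d ≤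
        c + D * A} := by
    have h := mul_mem_restrictSupport_le (rename_inl_mem_restrictSupport
      (weight_one_le_of_totalDegree_le (Finset.le_sup (f := fun x => (e x).totalDegree) hp₁)))
      (prod_pow_mem_restrictSupport_le hP₂ Finset.univ p.1.2)
    refine restrictSupport_mono K (fun d hd => ?_) h
    refine (Set.mem_ofPred.mp hd).trans ?_
    have : ((∑ i, p.1.2 i : ℕ) : ℤ) * A ≤ D * A := by
      exact_mod_cast Nat.mul_le_mul_right A hp₂
    exact add_le_add_right this _
  change Ideal.Quotient.mk JR (v p) ∈ _
  rw [(v p).as_sum, map_sum]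
  refine Submodule.sum_mem _ fun d hd => ?_
  have hsm : monomial d (coeff d (v p)) = coeff d (v p) • monomial d (1 : K) := by
    rw [smul_monomial, smul_eq_mul, mul_one]
  rw [hsm]
  refine Submodule.smul_mem _ _ (mk_monomial_mem_span J (hv₁ hd) (hv₂ hd) fun u γ hu hγ hdeg => ?_)
  refine Finset.mem_image.mpr ⟨⟨γ, u⟩, Finset.mem_sigma.mpr ⟨?_, ?_⟩, rfl⟩
  · exact mem_finsuppAntidiag_univ.mpr hγ
  · exact Finset.mem_filter.mpr ⟨mem_degreeLE.mpr hdeg, hu⟩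

/-- The power series `X ^ w / (1 - X) ^ (s + 1)` for `p = (w, s)`. -/
noncomputable def shiftedGeom (p : ℕ × ℕ) : PowerSeries ℕ :=
  PowerSeries.X ^ p.1 * PowerSeries.mk 1 ^ (p.2 + 1)

theorem X_pow_mul_mem_span_shiftedGeom (k : ℕ) {f : PowerSeries ℕ}
    (hf : f ∈ Submodule.span ℕ (Set.range shiftedGeom)) :
    PowerSeries.X ^ k * f ∈ Submodule.span ℕ (Set.range shiftedGeom) := by
  induction hf using Submodule.span_induction with
  | mem x hx =>
    obtain ⟨p, rfl⟩ := hx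
    refine Submodule.subset_span ⟨(k + p.1, p.2), ?_⟩
    rw [shiftedGeom, shiftedGeom, pow_add, mul_assoc]
  | zero => rw [mul_zero]; exact zero_mem _
  | add x y _ _ hx hy => rw [mul_add]; exact add_mem hx hy
  | smul c x _ hx => rw [mul_smul_comm]; exact Submodule.smul_mem _ _ hx

theorem mk_one_mul_mem_span_shiftedGeom {f : PowerSeries ℕ}
    (hf : f ∈ Submodule.span ℕ (Set.range shiftedGeom)) :
    PowerSeries.mk 1 * f ∈ Submodule.span ℕ (Set.range shiftedGeom) := by
  induction hf using Submodule.span_induction with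
  | mem x hx =>
    obtain ⟨p, rfl⟩ := hx
    refine Submodule.subset_span ⟨(p.1, p.2 + 1), ?_⟩
    rw [shiftedGeom, shiftedGeom, pow_succ _ (p.2 + 1)]
    ring
  | zero => rw [mul_zero]; exact zero_mem _
  | add x y _ _ hx hy => rw [mul_add]; exact add_mem hx hy
  | smul c x _ hx => rw [mul_smul_comm]; exact Submodule.smul_mem _ _ hx

/-- The slice of a set of multi-indices at the value `k` of the first coordinate. -/
def slice {n : ℕ} (T : Set (Fin (n + 1) →₀ ℕ)) (k : ℕ) : Set (Fin n →₀ ℕ) :=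
  {u | Finsupp.cons k u ∈ T}

theorem mem_slice {n : ℕ} {T : Set (Fin (n + 1) →₀ ℕ)} {k : ℕ} {u : Fin n →₀ ℕ} :
    u ∈ slice T k ↔ Finsupp.cons k u ∈ T :=
  Iff.rfl

theorem cons_mono {n : ℕ} {j k : ℕ} {u v : Fin n →₀ ℕ} (hjk : j ≤ k) (huv : u ≤ v) :
    Finsupp.cons j u ≤ Finsupp.cons k v := by
  intro i
  refine Fin.cases ?_ (fun i => ?_) i
  · simpa using hjk
  · simpa using huv i

theorem isLowerSet_slice {n : ℕ} {T : Set (Fin (n + 1) →₀ ℕ)} (hT : IsLowerSet T) (k : ℕ) :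
    IsLowerSet (slice T k) :=
  fun _ _ huv hu => hT (cons_mono le_rfl huv) hu

theorem exists_slice_eq {n : ℕ} {T : Set (Fin (n + 1) →₀ ℕ)} (hT : IsLowerSet T) :
    ∃ K, ∀ k, K ≤ k → slice T k = slice T K := by
  have hM : {u | Minimal (· ∉ T) u}.Finite :=
    WellQuasiOrderedLE.finite_of_isAntichain (setOfPred_minimal_antichain _)
  obtain ⟨K, hK⟩ := (hM.image fun u => u 0).bddAbove
  refine ⟨K, fun k hk => Set.Subset.antisymm
    (fun u hu => hT (cons_mono hk le_rfl) hu) fun u hu => ?_⟩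
  by_contra h
  obtain ⟨v, hv, hmin⟩ := exists_minimal_le_of_wellFoundedLT (· ∉ T) (Finsupp.cons k u) h
  refine hmin.1 (hT (fun i => ?_) hu)
  refine Fin.cases ?_ (fun i => ?_) i
  · simpa using hK (Set.mem_image_of_mem _ hmin)
  · simpa using hv i.succ

theorem countLE_succ {n : ℕ} (T : Set (Fin (n + 1) →₀ ℕ)) (t : ℕ) :
    countLE T t = ∑ k ∈ Finset.range (t + 1), countLE (slice T k) (t - k) := by
  classical
  simp only [countLE]
  rw [← Finset.card_sigma]
  refine Finset.card_nbij' (fun u => ⟨u 0, u.tail⟩) (fun p => Finsupp.cons p.1 p.2) ?_ ?_ ?_ ?_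
  · intro u hu
    rw [Finset.mem_coe, Finset.mem_filter, mem_degreeLE, Finsupp.degree_eq_sum,
      Fin.sum_univ_succ] at hu
    simp only [Finset.coe_sigma, Set.mem_sigma_iff, Finset.mem_coe, Finset.mem_filter,
      mem_degreeLE, Finset.mem_range, Finsupp.degree_eq_sum, Finsupp.tail_apply, mem_slice,
      Finsupp.cons_tail]
    refine ⟨by omega, by omega, hu.2⟩
  · rintro ⟨k, u⟩ hu
    simp only [Finset.coe_sigma, Set.mem_sigma_iff, Finset.mem_coe, Finset.mem_filter,
      mem_degreeLE, Finset.mem_range, Finsupp.degree_eq_sum, mem_slice] at hu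
    rw [Finset.mem_coe, Finset.mem_filter, mem_degreeLE, Finsupp.degree_eq_sum,
      Fin.sum_univ_succ]
    simp only [Finsupp.cons_zero, Finsupp.cons_succ]
    exact ⟨by omega, hu.2.2⟩
  · intro u _
    exact Finsupp.cons_tail u
  · rintro ⟨k, u⟩ _
    simp

/-- The generating function of a lower set of multi-indices is a combination of the series
`X ^ w / (1 - X) ^ (s + 1)` with natural coefficients. -/
theorem mk_countLE_mem_span {n : ℕ} {T : Set (Fin n →₀ ℕ)} (hT : IsLowerSet T) :
    PowerSeries.mk (countLE T) ∈ Submodule.span ℕ (Set.range shiftedGeom) := by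
  classical
  induction n with
  | zero =>
    by_cases h0 : (0 : Fin 0 →₀ ℕ) ∈ T
    · refine Submodule.subset_span ⟨(0, 0), ?_⟩
      ext t
      have : (degreeLE 0 t).filter (· ∈ T) = {0} := by
        ext u
        simp [mem_degreeLE, Subsingleton.elim u 0, h0]
      simp [shiftedGeom, countLE, this]
    · convert zero_mem (Submodule.span ℕ (Set.range shiftedGeom))
      ext t
      have : (degreeLE 0 t).filter (· ∈ T) = ∅ := by
        ext u
        simp [mem_degreeLE, Subsingleton.elim u 0, h0]
      simp [countLE, this]
  | succ n ih =>
    obtain ⟨K, hK⟩ := exists_slice_eq hT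
    have hsum : PowerSeries.mk (countLE T) =
        ∑ k ∈ Finset.range K, PowerSeries.X ^ k * PowerSeries.mk (countLE (slice T k)) +
          PowerSeries.X ^ K * (PowerSeries.mk 1 * PowerSeries.mk (countLE (slice T K))) := by
      ext t
      rw [PowerSeries.coeff_mk, countLE_succ, map_add, map_sum]
      simp only [PowerSeries.coeff_X_pow_mul', PowerSeries.coeff_mk]
      rw [PowerSeries.coeff_mul]
      simp only [PowerSeries.coeff_mk, Pi.one_apply, one_mul]
      by_cases h : K ≤ t
      · obtain ⟨d, rfl⟩ := Nat.exists_eq_add_of_le h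
        rw [if_pos h, add_assoc, Finset.sum_range_add]
        congr 1
        · refine Finset.sum_congr rfl fun k hk => ?_
          rw [if_pos ((Finset.mem_range.1 hk).le.trans h)]
        · rw [Nat.add_sub_cancel_left, Finset.Nat.sum_antidiagonal_eq_sum_range_succ_mk]
          refine Finset.sum_congr rfl fun k _ => ?_
          rw [hK (K + k) (Nat.le_add_right _ _), Nat.add_sub_add_left]
      · rw [if_neg h, add_zero, ← Finset.sum_filter]
        refine Finset.sum_congr ?_ fun _ _ => rfl
        ext k
        simp only [Finset.mem_range, Finset.mem_filter]
        omega
    rw [hsum]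
    exact add_mem (sum_mem fun k _ => X_pow_mul_mem_span_shiftedGeom k (ih (isLowerSet_slice hT k)))
      (X_pow_mul_mem_span_shiftedGeom K
        (mk_one_mul_mem_span_shiftedGeom (ih (isLowerSet_slice hT K))))

theorem coeff_mk_one_pow_succ (j k : ℕ) :
    PowerSeries.coeff j ((PowerSeries.mk 1 : PowerSeries ℕ) ^ (k + 1)) = (j + k).choose k := by
  induction k generalizing j with
  | zero => simp
  | succ k ih =>
    rw [pow_succ, PowerSeries.coeff_mul]
    simp only [ih, PowerSeries.coeff_mk, Pi.one_apply, mul_one]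
    rw [Finset.Nat.sum_antidiagonal_eq_sum_range_succ_mk]
    exact Nat.sum_range_add_choose j k

theorem coeff_shiftedGeom_mul (t m : ℕ) (p : ℕ × ℕ) :
    PowerSeries.coeff t (shiftedGeom p * PowerSeries.mk 1 ^ m) =
      if p.1 ≤ t then (t - p.1 + (p.2 + m)).choose (p.2 + m) else 0 := by
  rw [shiftedGeom, mul_assoc, ← pow_add, add_right_comm, PowerSeries.coeff_X_pow_mul',
    coeff_mk_one_pow_succ]

/-- The coefficients in a decomposition of the generating function of a lower set. -/
theorem exists_mk_countLE_eq {n : ℕ} {T : Set (Fin n →₀ ℕ)} (hT : IsLowerSet T) :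
    ∃ c : ℕ × ℕ →₀ ℕ, ∀ t m, PowerSeries.coeff t (PowerSeries.mk (countLE T) *
      PowerSeries.mk 1 ^ m) = ∑ p ∈ c.support, c p *
        if p.1 ≤ t then (t - p.1 + (p.2 + m)).choose (p.2 + m) else 0 := by
  obtain ⟨c, hc⟩ := Finsupp.mem_span_range_iff_exists_finsupp.1 (mk_countLE_mem_span hT)
  refine ⟨c, fun t m => ?_⟩
  rw [← hc, Finsupp.sum, Finset.sum_mul, map_sum]
  refine Finset.sum_congr rfl fun p _ => ?_
  rw [smul_mul_assoc, map_nsmul, coeff_shiftedGeom_mul, smul_eq_mul]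

open Classical in
theorem coeff_mk_countLE_mul {n : ℕ} (T : Set (Fin n →₀ ℕ)) (t m : ℕ) :
    PowerSeries.coeff t (PowerSeries.mk (countLE T) * PowerSeries.mk 1 ^ m) =
      ∑ u ∈ (degreeLE n t).filter (· ∈ T), (degreeLE m (t - u.degree)).card := by
  have h : ∀ i ≤ t, countLE T i = ∑ u ∈ (degreeLE n t).filter (· ∈ T),
      PowerSeries.coeff i (PowerSeries.X ^ u.degree * PowerSeries.mk 1) := by
    intro i hi
    simp only [PowerSeries.coeff_X_pow_mul', PowerSeries.coeff_mk, Pi.one_apply, countLE]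
    rw [← Finset.card_filter, Finset.filter_filter]
    congr 1
    ext u
    simp only [Finset.mem_filter, mem_degreeLE]
    exact ⟨fun hu => ⟨hu.1.trans hi, hu.2, hu.1⟩, fun hu => ⟨hu.2.2, hu.2.1⟩⟩
  rw [PowerSeries.coeff_mul]
  rw [Finset.sum_congr rfl fun p hp => by
    rw [PowerSeries.coeff_mk, h p.1 (Finset.HasAntidiagonal.antidiagonal.fst_le hp),
      Finset.sum_mul]]
  rw [Finset.sum_comm]
  refine Finset.sum_congr rfl fun u hu => ?_
  rw [← PowerSeries.coeff_mul, mul_assoc, ← pow_succ', PowerSeries.coeff_X_pow_mul',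
    if_pos (mem_degreeLE.1 (Finset.mem_filter.1 hu).1), coeff_mk_one_pow_succ, card_degreeLE]

open Classical in
/-- Division with remainder of exponents by the weights `b`. -/
theorem sum_card_degreeLE_le {n m : ℕ} {T : Set (Fin n →₀ ℕ)} {b : Fin m → ℕ} (hb : ∀ j, 1 ≤ b j)
    {t N : ℕ} (hN : ∀ A : Finset ((Fin n →₀ ℕ) × (Fin m →₀ ℕ)),
      (∀ a ∈ A, a.1 ∈ T ∧ a.1.degree + ∑ j, b j * a.2 j ≤ t) → A.card ≤ N) :
    ∑ u ∈ (degreeLE n t).filter (· ∈ T), (degreeLE m (t - u.degree)).card ≤ (∏ j, b j) * N := by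
  let q : (Fin m →₀ ℕ) → (Fin m →₀ ℕ) := fun e => Finsupp.equivFunOnFinite.symm fun j => e j / b j
  let P := ((degreeLE n t).filter (· ∈ T)).sigma fun u => degreeLE m (t - u.degree)
  let A := P.image fun p => (p.1, q p.2)
  have hA : A.card ≤ N := by
    refine hN A fun a ha => ?_
    obtain ⟨⟨u, e⟩, hp, rfl⟩ := Finset.mem_image.1 ha
    simp only [P, Finset.mem_sigma, Finset.mem_filter, mem_degreeLE] at hp
    refine ⟨hp.1.2, ?_⟩
    have h : ∑ j, b j * q e j ≤ e.degree := by
      rw [Finsupp.degree_eq_sum]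
      exact Finset.sum_le_sum fun j _ => Nat.mul_div_le (e j) (b j)
    have := hp.1.1
    have := hp.2
    simp only
    omega
  calc _ = P.card := (Finset.card_sigma _ _).symm
    _ ≤ (Fintype.piFinset (fun j => Finset.range (b j)) ×ˢ A).card := by
      refine Finset.card_le_card_of_injOn (fun p => (fun j => p.2 j % b j, (p.1, q p.2))) ?_ ?_
      · intro p hp
        rw [Finset.mem_coe, Finset.mem_product]
        exact ⟨Fintype.mem_piFinset.2 fun j => Finset.mem_range.2 (Nat.mod_lt _ (hb j)),
          Finset.mem_image_of_mem _ hp⟩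
      · rintro ⟨u, d⟩ _ ⟨v, e⟩ _ h
        simp only [Prod.mk.injEq] at h
        obtain ⟨h1, rfl, h2⟩ := h
        congr 1
        ext j
        have h1j := congrFun h1 j
        have h2j : d j / b j = e j / b j := DFunLike.congr_fun h2 j
        rw [← Nat.div_add_mod (d j) (b j), ← Nat.div_add_mod (e j) (b j), h1j, h2j]
    _ = (∏ j, b j) * A.card := by
      rw [Finset.card_product, Fintype.card_piFinset]
      simp
    _ ≤ _ := Nat.mul_le_mul_left _ hA

theorem tendsto_choose_div_pow {a j k : ℕ} (hjk : j ≤ k) :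
    Filter.Tendsto (fun e : ℕ => ((e + a).choose j : ℝ) / (e : ℝ) ^ k) Filter.atTop
      (nhds (if j = k then 1 / (k.factorial : ℝ) else 0)) := by
  have h1 : Filter.Tendsto (fun e : ℕ => ((e + a : ℕ) : ℝ) / e) Filter.atTop (nhds 1) := by
    have h : Filter.Tendsto (fun e : ℕ => 1 + (a : ℝ) / e) Filter.atTop (nhds (1 + 0)) :=
      tendsto_const_nhds.add (tendsto_const_div_atTop_nhds_zero_nat _)
    rw [add_zero] at h
    refine h.congr' ?_
    filter_upwards [Filter.eventually_gt_atTop 0] with e he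
    have : (e : ℝ) ≠ 0 := by positivity
    push_cast
    field_simp
  have h2 : Filter.Tendsto (fun e : ℕ => ((e + a).choose j : ℝ) / ((e + a : ℕ) : ℝ) ^ j)
      Filter.atTop (nhds (1 / (j.factorial : ℝ))) := by
    have h : Filter.Tendsto (fun e : ℕ => (e.choose j : ℝ) / (e : ℝ) ^ j)
        Filter.atTop (nhds (1 / (j.factorial : ℝ))) := by
      have hz : ∀ᶠ e : ℕ in Filter.atTop, ((e : ℝ) ^ j / j.factorial : ℝ) ≠ 0 := by
        filter_upwards [Filter.eventually_gt_atTop 0] with e he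
        positivity
      have h := ((Asymptotics.isEquivalent_iff_tendsto_one hz).1
        (isEquivalent_choose j)).mul_const (1 / (j.factorial : ℝ))
      rw [one_mul] at h
      refine h.congr fun e => ?_
      have : (j.factorial : ℝ) ≠ 0 := by positivity
      simp only [Pi.div_apply]
      field_simp
    exact h.comp (Filter.tendsto_add_atTop_nat a)
  have h3 : Filter.Tendsto (fun e : ℕ => (1 : ℝ) / (e : ℝ) ^ (k - j)) Filter.atTop
      (nhds (if j = k then 1 else 0)) := by
    split_ifs with h
    · simp [h]
    · simp only [one_div]
      exact tendsto_inv_atTop_zero.comp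
        ((Filter.tendsto_pow_atTop (by omega)).comp tendsto_natCast_atTop_atTop)
  have h4 := (h2.mul (h1.pow j)).mul h3
  have h5 : (if j = k then 1 / (k.factorial : ℝ) else 0) =
      1 / (j.factorial : ℝ) * 1 ^ j * (if j = k then 1 else 0) := by
    split_ifs with h
    · simp [h]
    · simp
  rw [h5]
  refine h4.congr' ?_
  filter_upwards [Filter.eventually_gt_atTop 0] with e he
  have he' : (e : ℝ) ≠ 0 := by positivity
  have he'' : ((e + a : ℕ) : ℝ) ≠ 0 := by positivity
  rw [← Nat.add_sub_of_le hjk, Nat.add_sub_cancel_left, pow_add, div_pow]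
  field_simp

theorem tendsto_sum_choose_div_pow {ι : Type*} {s : Finset ι} {N : ℕ} {c a k : ι → ℕ}
    (hk : ∀ i ∈ s, k i ≤ N) :
    Filter.Tendsto (fun e : ℕ => ((∑ i ∈ s, c i * (e + a i).choose (k i) : ℕ) : ℝ) /
      (e : ℝ) ^ N) Filter.atTop
      (nhds (((∑ i ∈ s with k i = N, c i : ℕ) : ℝ) * (1 / (N.factorial : ℝ)))) := by
  have := tendsto_finsetSum s fun i hi =>
    (tendsto_choose_div_pow (a := a i) (hk i hi)).const_mul (c i : ℝ)
  convert this using 2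
  · push_cast
    rw [Finset.sum_div]
    exact Finset.sum_congr rfl fun i _ => by ring
  · push_cast
    rw [Finset.sum_filter, Finset.sum_mul]
    refine Finset.sum_congr rfl fun i _ => ?_
    split_ifs <;> simp

/-- Comparison of the leading coefficients of two sums of binomial coefficients. -/
theorem sum_filter_le_of_forall_choose_le {ι κ : Type*} {s : Finset ι} {t : Finset κ} {N : ℕ}
    {c : ι → ℕ} {d : κ → ℕ} {a k : ι → ℕ} {a' k' : κ → ℕ} (hk : ∀ i ∈ s, k i ≤ N)
    (hk' : ∀ i ∈ t, k' i ≤ N) (h : ∀ e, ∑ i ∈ s, c i * (e + a i).choose (k i) ≤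
      ∑ i ∈ t, d i * (e + a' i).choose (k' i)) :
    ∑ i ∈ s with k i = N, c i ≤ ∑ i ∈ t with k' i = N, d i := by
  have hle := le_of_tendsto_of_tendsto' (tendsto_sum_choose_div_pow hk)
    (tendsto_sum_choose_div_pow hk') fun e =>
      div_le_div_of_nonneg_right (Nat.cast_le.2 (h e)) (by positivity)
  have hN : (0 : ℝ) < 1 / (N.factorial : ℝ) := by positivity
  exact_mod_cast le_of_mul_le_mul_right hle hN

/-- A lower set whose products with weighted multi-indices are not too numerous is counted by a
combination of binomial coefficients with controlled leading coefficient. -/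
theorem exists_countLE_le {n m : ℕ} {T : Set (Fin n →₀ ℕ)} (hT : IsLowerSet T) {b : Fin m → ℕ}
    (hb : ∀ j, 1 ≤ b j) (hN : ∀ t, ∀ A : Finset ((Fin n →₀ ℕ) × (Fin m →₀ ℕ)),
      (∀ a ∈ A, a.1 ∈ T ∧ a.1.degree + ∑ j, b j * a.2 j ≤ t) → A.card ≤ (t + n).choose n) :
    ∃ c : ℕ × ℕ →₀ ℕ, (∀ t, countLE T t ≤ ∑ p ∈ c.support, c p * (t + p.2).choose p.2) ∧
      (∀ p ∈ c.support, p.2 + m ≤ n) ∧ ∑ p ∈ c.support with p.2 + m = n, c p ≤ ∏ j, b j := by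
  classical
  obtain ⟨c, hc⟩ := exists_mk_countLE_eq hT
  set W := c.support.sup Prod.fst with hW
  have hbound : ∀ e, ∑ p ∈ c.support, c p * (e + (p.2 + m)).choose (p.2 + m) ≤
      (∏ j, b j) * (e + (W + n)).choose n := by
    intro e
    calc _ ≤ ∑ p ∈ c.support, c p * (if p.1 ≤ e + W then
          (e + W - p.1 + (p.2 + m)).choose (p.2 + m) else 0) := by
          refine Finset.sum_le_sum fun p hp => Nat.mul_le_mul_left _ ?_
          have : p.1 ≤ W := Finset.le_sup (f := Prod.fst) hp
          rw [if_pos (by omega)]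
          exact Nat.choose_le_choose _ (by omega)
      _ ≤ _ := by
          rw [← hc, coeff_mk_countLE_mul, ← add_assoc]
          exact sum_card_degreeLE_le hb (hN (e + W))
  have hdeg : ∀ p ∈ c.support, p.2 + m ≤ n := by
    intro p hp
    by_contra! hlt
    have h := sum_filter_le_of_forall_choose_le (s := {()}) (t := {()}) (N := n + 1)
      (c := fun _ => 1) (a := fun _ => n + 1) (k := fun _ => n + 1) (d := fun _ => ∏ j, b j)
      (a' := fun _ => W + n) (k' := fun _ => n) (by simp) (by simp) (fun e => by
        simp only [Finset.sum_singleton, one_mul]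
        refine le_trans ?_ (hbound e)
        refine le_trans ?_ (Finset.single_le_sum
          (f := fun p => c p * (e + (p.2 + m)).choose (p.2 + m)) (fun _ _ => Nat.zero_le _) hp)
        refine le_trans ?_ (Nat.le_mul_of_pos_left _
          (Nat.pos_of_ne_zero (Finsupp.mem_support_iff.1 hp)))
        rw [Nat.choose_symm_add.symm, ← Nat.choose_symm_add (b := p.2 + m)]
        exact Nat.choose_le_choose _ (by omega))
    simp at h
  refine ⟨c, fun t => ?_, hdeg, ?_⟩
  · have h := hc t 0
    rw [pow_zero, mul_one, PowerSeries.coeff_mk] at h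
    rw [h]
    refine Finset.sum_le_sum fun p _ => Nat.mul_le_mul_left _ ?_
    split_ifs
    · exact Nat.choose_le_choose _ (by omega)
    · exact Nat.zero_le _
  · have h := sum_filter_le_of_forall_choose_le (t := {()}) (N := n)
      (c := c) (a := fun p => p.2 + m) (k := fun p => p.2 + m) (d := fun _ => ∏ j, b j)
      (a' := fun _ => W + n) (k' := fun _ => n) hdeg (by simp) (fun e => by
        simpa using hbound e)
    simpa using h

theorem completeSym_eq_sum_finsuppAntidiag {k : ℕ} (r : ℕ) (c : Fin k → ℕ) :
    completeSym r c = ∑ i ∈ Finset.univ.finsuppAntidiag r, ∏ t, c t ^ i t := by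
  refine Finset.sum_nbij' (fun e => Finsupp.equivFunOnFinite.symm fun t => (e t : ℕ))
    (fun i t => Fin.ofNat (r + 1) (i t)) ?_ ?_ ?_ ?_ ?_
  · intro e he
    simpa [mem_finsuppAntidiag_univ] using he
  · intro i hi
    rw [mem_finsuppAntidiag_univ] at hi
    have h : ∀ t, i t < r + 1 := fun t =>
      Nat.lt_succ_of_le (hi ▸ Finset.single_le_sum (fun _ _ => Nat.zero_le _) (Finset.mem_univ t))
    simpa [Nat.mod_eq_of_lt (h _)] using hi
  · intro e _
    ext t
    simp
  · intro i hi
    rw [mem_finsuppAntidiag_univ] at hi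
    have h : ∀ t, i t < r + 1 := fun t =>
      Nat.lt_succ_of_le (hi ▸ Finset.single_le_sum (fun _ _ => Nat.zero_le _) (Finset.mem_univ t))
    ext t
    simp [Nat.mod_eq_of_lt (h t)]
  · intro e _
    simp

/-- The iterated Vandermonde identity. -/
theorem choose_sum_eq {k : ℕ} (y : Fin k → ℕ) (j : ℕ) :
    (∑ t, y t).choose j = ∑ i ∈ Finset.univ.finsuppAntidiag j, ∏ t, (y t).choose (i t) := by
  have h := PowerSeries.coeff_prod
    (fun t => (((1 + Polynomial.X) ^ y t : Polynomial ℕ) : PowerSeries ℕ)) j Finset.univ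
  simp only [Polynomial.coeff_coe, Polynomial.coeff_one_add_X_pow, Nat.cast_id] at h
  simp only [Polynomial.coe_pow] at h
  rw [← h, Finset.prod_pow_eq_pow_sum, ← Polynomial.coe_pow, Polynomial.coeff_coe,
    Polynomial.coeff_one_add_X_pow, Nat.cast_id]

theorem sum_prod_choose_add {m : ℕ} (i : Fin (m + 1) →₀ ℕ) (D : ℕ) :
    ∑ γ ∈ Finset.univ.finsuppAntidiag D, ∏ t, (γ t + i t).choose (i t) =
      (D + (m + ∑ t, i t)).choose (m + ∑ t, i t) := by
  rw [← coeff_mk_one_pow_succ, show m + ∑ t, i t + 1 = ∑ t, (i t + 1) by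
      simp [Finset.sum_add_distrib]; omega,
    ← Finset.prod_pow_eq_pow_sum, PowerSeries.coeff_prod]
  simp only [coeff_mk_one_pow_succ]

theorem choose_mul_le (b γ i : ℕ) : (b * γ).choose i ≤ b ^ i * (γ + i).choose i := by
  refine Nat.le_of_mul_le_mul_left ?_ (Nat.factorial_pos i)
  calc i.factorial * (b * γ).choose i = (b * γ).descFactorial i :=
        (Nat.descFactorial_eq_factorial_mul_choose _ _).symm
    _ ≤ (b * γ) ^ i := Nat.descFactorial_le_pow _ _
    _ ≤ b ^ i * (γ + 1) ^ i := by
        rw [mul_pow]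
        exact Nat.mul_le_mul_left _ (Nat.pow_le_pow_left (Nat.le_succ _) _)
    _ ≤ b ^ i * (γ + 1).ascFactorial i := Nat.mul_le_mul_left _ (Nat.pow_succ_le_ascFactorial _ _)
    _ = _ := by rw [Nat.ascFactorial_eq_factorial_mul_choose]; ring

theorem sum_choose_sum_mul_le {m : ℕ} (b : Fin (m + 1) → ℕ) (x s D : ℕ) :
    ∑ γ ∈ (Finset.univ : Finset (Fin (m + 1))).finsuppAntidiag D, (x + ∑ t, b t * γ t).choose s ≤
      ∑ q ∈ Finset.HasAntidiagonal.antidiagonal s,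
        x.choose q.1 * completeSym q.2 b * (D + (m + q.2)).choose (m + q.2) := by
  simp only [Nat.add_choose_eq x]
  rw [Finset.sum_comm]
  refine Finset.sum_le_sum fun q _ => ?_
  rw [← Finset.mul_sum, mul_assoc, completeSym_eq_sum_finsuppAntidiag, Finset.sum_mul]
  refine Nat.mul_le_mul_left _ ?_
  simp only [choose_sum_eq]
  rw [Finset.sum_comm]
  refine Finset.sum_le_sum fun i hi => ?_
  rw [mem_finsuppAntidiag_univ] at hi
  rw [← hi, ← sum_prod_choose_add, Finset.mul_sum]
  refine Finset.sum_le_sum fun γ _ => ?_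
  rw [← Finset.prod_mul_distrib]
  exact Finset.prod_le_prod' fun t _ => choose_mul_le _ _ _

/-- The conclusion of the counting argument. -/
theorem le_prod_mul_completeSym {n m N x : ℕ} {T : Set (Fin n →₀ ℕ)} (hT : IsLowerSet T)
    {b : Fin m → ℕ} (hb : ∀ j, 1 ≤ b j)
    (hN : ∀ t, ∀ A : Finset ((Fin n →₀ ℕ) × (Fin m →₀ ℕ)),
      (∀ a ∈ A, a.1 ∈ T ∧ a.1.degree + ∑ j, b j * a.2 j ≤ t) → A.card ≤ (t + n).choose n)
    {b' : Fin (m + 1) → ℕ} (h : ∀ D, N * (D + n).choose n ≤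
      ∑ γ ∈ (Finset.univ : Finset (Fin (m + 1))).finsuppAntidiag D,
        countLE T (x + ∑ t, b' t * γ t)) :
    N ≤ (∏ j, b j) * completeSym (n - m) b' := by
  obtain ⟨c, hle, hdeg, hlead⟩ := exists_countLE_le hT hb hN
  have hD : ∀ D, N * (D + n).choose n ≤
      ∑ r ∈ c.support.sigma fun p => Finset.HasAntidiagonal.antidiagonal p.2,
        c r.1 * ((x + r.1.2).choose r.2.1 * completeSym r.2.2 b') *
          (D + (m + r.2.2)).choose (m + r.2.2) := by
    intro D
    rw [Finset.sum_sigma]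
    calc _ ≤ _ := h D
      _ ≤ ∑ γ ∈ (Finset.univ : Finset (Fin (m + 1))).finsuppAntidiag D, ∑ p ∈ c.support,
          c p * (x + p.2 + ∑ t, b' t * γ t).choose p.2 := by
        refine Finset.sum_le_sum fun γ _ => (hle _).trans_eq ?_
        simp only [add_right_comm]
      _ ≤ _ := by
        rw [Finset.sum_comm]
        refine Finset.sum_le_sum fun p _ => ?_
        rw [← Finset.mul_sum]
        refine (Nat.mul_le_mul_left _ (sum_choose_sum_mul_le b' _ _ D)).trans_eq ?_
        rw [Finset.mul_sum]
        exact Finset.sum_congr rfl fun q _ => by ring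
  have hfinal := sum_filter_le_of_forall_choose_le (s := {()}) (N := n) (c := fun _ => N)
    (t := c.support.sigma fun p => Finset.HasAntidiagonal.antidiagonal p.2)
    (a := fun _ => n) (k := fun _ => n) (a' := fun r => m + r.2.2) (k' := fun r => m + r.2.2)
    (by simp) (fun r hr => by
      rw [Finset.mem_sigma, Finset.HasAntidiagonal.mem_antidiagonal] at hr
      have := hdeg r.1 hr.1
      omega) (fun D => by simpa using hD D)
  calc N ≤ _ := by simpa using hfinal
    _ ≤ ∑ p ∈ c.support with p.2 + m = n, c p * completeSym (n - m) b' := by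
      rw [Finset.sum_filter, Finset.sum_filter, Finset.sum_sigma]
      refine Finset.sum_le_sum fun p hp => ?_
      have hpn := hdeg p hp
      split_ifs with hp'
      · rw [Finset.sum_eq_single_of_mem (0, p.2) (by simp)]
        · rw [if_pos (show m + p.2 = n by omega), show n - m = p.2 by omega]
          simp
        · rintro ⟨i, j⟩ hq hne
          rw [Finset.HasAntidiagonal.mem_antidiagonal] at hq
          refine if_neg fun hj => hne ?_
          simp only [Prod.mk.injEq] at hq hj ⊢
          omega
      · refine (Finset.sum_eq_zero fun q hq => ?_).le
        rw [Finset.HasAntidiagonal.mem_antidiagonal] at hq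
        exact if_neg (show ¬ m + q.2 = n by omega)
    _ ≤ _ := by
      rw [← Finset.sum_mul]
      exact Nat.mul_le_mul_right _ hlead

theorem stmt5 (n m : ℕ) (hmn : m ≤ n)
    (a : Fin n → ℕ) (b : Fin m → ℕ) (hb : ∀ j, 1 ≤ b j)
    (F : Fin n → MvPolynomial (Fin n) ℂ) (hF : ∀ i, (F i).totalDegree ≤ a i)
    (g : Fin m → MvPolynomial (Fin n) ℂ) (hg : ∀ j, (g j).totalDegree = b j)
    (S : Set ((Fin n → ℂ) × (Fin m → ℂ)))
    (hS : S = {p | (∀ i, eval p.1 (F i) = ∑ j, p.2 j * eval p.1 (pderiv i (g j))) ∧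
        (∀ j, eval p.1 (g j) = 0)})
    (hfin : S.Finite) :
    (Prod.fst '' S).ncard ≤
      (∏ j, b j) * completeSym (n - m) (Fin.cons (Finset.univ.sup a) b) := by
  classical
  rcases n with _ | k
  · obtain rfl : m = 0 := Nat.le_zero.1 hmn
    refine (Set.ncard_le_one_of_subsingleton _).trans ?_
    simp [completeSym]
  let G : Fin m → MvPolynomial (Fin (k + 1) ⊕ Fin m) ℂ := fun j => rename Sum.inl (g j)
  let P : Fin (k + 1) → MvPolynomial (Fin (k + 1) ⊕ Fin m) ℂ := fun i =>
    rename Sum.inl (F i) - ∑ j, X (Sum.inr j) * rename Sum.inl (pderiv i (g j))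
  have hmem : ∀ x l, Sum.elim x l ∈ zeroLocus ℂ (Ideal.span (Set.range G ∪ Set.range P)) ↔
      (x, l) ∈ S := by
    intro x l
    have hx : ∀ f : MvPolynomial (Fin (k + 1)) ℂ,
        aeval (Sum.elim x l) (rename Sum.inl f) = eval x f := by
      intro f
      rw [aeval_rename, Sum.elim_comp_inl, aeval_eq_eval]
    rw [hS, zeroLocus_span, Set.mem_ofPred_eq, Set.mem_ofPred_eq]
    simp only [Set.mem_union, Set.mem_range, or_imp, forall_and, forall_exists_index,
      forall_apply_eq_imp_iff, G, P, map_sub, map_sum, map_mul, aeval_X, Sum.elim_inr, hx,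
      sub_eq_zero]
    exact and_comm
  have hlocus : (zeroLocus ℂ (Ideal.span (Set.range G ∪ Set.range P))).Finite := by
    refine Set.Finite.of_finite_image (f := fun z => (z ∘ Sum.inl, z ∘ Sum.inr))
      (hfin.subset ?_) ?_
    · rintro _ ⟨z, hz, rfl⟩
      rw [← hmem, Sum.elim_comp_inl_inr]
      exact hz
    · intro z _ w _ h
      rw [← Sum.elim_comp_inl_inr z, ← Sum.elim_comp_inl_inr w]
      simp only [Prod.mk.injEq] at h
      rw [h.1, h.2]
  have hZ : (Prod.fst '' S).Finite := hfin.image _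
  obtain ⟨c, hc⟩ := exists_card_mul_choose_le (A := Finset.univ.sup a)
    (fun i => (hF i).trans (Finset.le_sup (Finset.mem_univ i))) (fun j => (hg j).le)
    (G := G) (fun _ => rfl) (P := P) (fun _ => rfl) hlocus hZ.toFinset (fun x hx => by
      obtain ⟨⟨x, l⟩, hp, rfl⟩ := hZ.mem_toFinset.1 hx
      exact ⟨l, (hmem x l).2 hp⟩)
  rw [Set.ncard_eq_toFinset_card _ hZ]
  refine le_prod_mul_completeSym (isLowerSet_stdMonomials (residualIdeal ⊥ g)) hb
    (fun t A hA => ?_) hc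
  rw [← card_degreeLE]
  refine card_le_of_no_relation (fun j => (hg j).le) (fun h hh h0 => ?_) hA
    fun u hu => mem_degreeLE.2 hu
  exact eq_zero_of_eval_mem (I := ⊥)
    (fun f hf hs => eq_zero_of_support_subset_stdMonomials hf hs) h hh
    (by rw [h0]; exact zero_mem _)
end
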